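/- Let A be a compact homologically smooth DG algebra over a field k. Then the triangulated category Ho_per(A) of perfect modules admits a strong generator: there exists an object E and an integer n such that every object of Ho_per(A) can be built from E using shifts, finite direct sums, direct summands, and at most n−1 cones. -/

import Mathlib

/- Framework: differential graded algebras (internal ℤ-grading), right DG modules,
DG bimodules, homotopy-theoretic notions (twisted modules, perfectness,
homological smoothness), cohomology and Hochschild homology. -/

open DirectSum TensorProduct

noncomputable section
set_option linter.unusedVariables false

/-- `(-1)^i` for `i : ℤ`, valued in `ℤ`. -/
def sgnz (i : ℤ) : ℤ := if Even i then 1 else -1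

/-- `(-1)^i` for `i : ℤ`, valued in a field `k`. -/
def sgnk (k : Type) [Field k] (i : ℤ) : k := if Even i then 1 else -1

/-- A differential graded algebra over a field `k`: a `k`-algebra with an internal
ℤ-grading and a square-zero degree `+1` differential satisfying the graded Leibniz rule. -/
structure DGAlgebra (k : Type) [Field k] : Type 1 where
  R : Type
  [ring : Ring R]
  [alg : Algebra k R]
  gr : ℤ → Submodule k R
  [dec : DirectSum.Decomposition gr]
  one_mem : (1 : R) ∈ gr 0
  mul_mem : ∀ {i j : ℤ} {x y : R}, x ∈ gr i → y ∈ gr j → x * y ∈ gr (i + j)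
  d : R →ₗ[k] R
  d_deg : ∀ (i : ℤ), ∀ x ∈ gr i, d x ∈ gr (i + 1)
  d_sq : ∀ x : R, d (d x) = 0
  leibniz : ∀ (i : ℤ), ∀ x ∈ gr i, ∀ y : R,
    d (x * y) = d x * y + sgnz i • (x * d y)

attribute [instance] DGAlgebra.ring DGAlgebra.alg DGAlgebra.dec

variable {k : Type} [Field k]

/-- A right DG module over a DG algebra `A`.  The right action of `x : A` on `m`
is written `act x m` (representing `m · x`). -/
structure DGMod (A : DGAlgebra k) : Type 1 where
  M : Type
  [acg : AddCommGroup M]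
  [kmod : Module k M]
  gm : ℤ → Submodule k M
  [dec : DirectSum.Decomposition gm]
  act : A.R →ₗ[k] M →ₗ[k] M
  act_one : ∀ m : M, act 1 m = m
  act_mul : ∀ (x y : A.R) (m : M), act (x * y) m = act y (act x m)
  act_deg : ∀ (i j : ℤ) (x : A.R) (m : M), x ∈ A.gr i → m ∈ gm j → act x m ∈ gm (j + i)
  D : M →ₗ[k] M
  D_deg : ∀ (j : ℤ), ∀ m ∈ gm j, D m ∈ gm (j + 1)
  D_sq : ∀ m : M, D (D m) = 0
  leibniz : ∀ (i j : ℤ) (x : A.R) (m : M), x ∈ A.gr i → m ∈ gm j →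
    D (act x m) = act x (D m) + sgnz j • act (A.d x) m

attribute [instance] DGMod.acg DGMod.kmod DGMod.dec

variable {A : DGAlgebra k}

/-- Morphisms of right DG modules (closed, degree 0). -/
structure DGHom (X Y : DGMod A) where
  f : X.M →ₗ[k] Y.M
  deg : ∀ (j : ℤ), ∀ m ∈ X.gm j, f m ∈ Y.gm j
  actc : ∀ (x : A.R) (m : X.M), f (X.act x m) = Y.act x (f m)
  comm : ∀ m : X.M, f (X.D m) = Y.D (f m)

/-- The identity morphism. -/
def DGHom.id (X : DGMod A) : DGHom X X :=
  ⟨LinearMap.id, fun _ _ h => h, fun _ _ => rfl, fun _ => rfl⟩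

/-- Composition of morphisms of DG modules. -/
def DGHom.comp {X Y Z : DGMod A} (G : DGHom Y Z) (F : DGHom X Y) : DGHom X Z :=
  ⟨G.f ∘ₗ F.f, fun j m h => G.deg j _ (F.deg j m h),
    fun x m => by simp [LinearMap.comp_apply, F.actc, G.actc],
    fun m => by simp [LinearMap.comp_apply, F.comm, G.comm]⟩

/-- The zero morphism. -/
def DGHom.zero (X Y : DGMod A) : DGHom X Y :=
  ⟨0, fun j _ _ => (Y.gm j).zero_mem, fun _ _ => by simp, fun _ => by simp⟩

/-- Chain homotopy between two morphisms of DG modules. -/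
def Homotopic {X Y : DGMod A} (F G : DGHom X Y) : Prop :=
  ∃ h : X.M →ₗ[k] Y.M,
    (∀ (j : ℤ), ∀ m ∈ X.gm j, h m ∈ Y.gm (j - 1)) ∧
    (∀ (x : A.R) (m : X.M), h (X.act x m) = Y.act x (h m)) ∧
    ∀ m : X.M, F.f m - G.f m = Y.D (h m) + h (X.D m)

/-- Cycles of degree `n` of a complex given by a grading and a differential. -/
def Zg {M : Type} [AddCommGroup M] [Module k M]
    (gm : ℤ → Submodule k M) (Dm : M →ₗ[k] M) (n : ℤ) : Submodule k M :=
  gm n ⊓ LinearMap.ker Dm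

/-- Boundaries of degree `n`. -/
def Bg {M : Type} [AddCommGroup M] [Module k M]
    (gm : ℤ → Submodule k M) (Dm : M →ₗ[k] M) (n : ℤ) : Submodule k M :=
  gm n ⊓ LinearMap.range Dm

/-- Degree `n` cohomology of a complex. -/
def Hg {M : Type} [AddCommGroup M] [Module k M]
    (gm : ℤ → Submodule k M) (Dm : M →ₗ[k] M) (n : ℤ) : Type :=
  ↥(Zg gm Dm n) ⧸ (Submodule.comap (Zg gm Dm n).subtype (Bg gm Dm n))

instance {M : Type} [AddCommGroup M] [Module k M]
    (gm : ℤ → Submodule k M) (Dm : M →ₗ[k] M) (n : ℤ) : AddCommGroup (Hg gm Dm n) := by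
  unfold Hg; infer_instance

instance {M : Type} [AddCommGroup M] [Module k M]
    (gm : ℤ → Submodule k M) (Dm : M →ₗ[k] M) (n : ℤ) : Module k (Hg gm Dm n) := by
  unfold Hg; infer_instance

/-- `f` induces an isomorphism on the homology of two complexes presented by
(families of) cycle and boundary submodules. -/
def InducesHIso {M₁ M₂ : Type} [AddCommGroup M₁] [Module k M₁] [AddCommGroup M₂] [Module k M₂]
    (Z₁ B₁ : ℤ → Submodule k M₁) (Z₂ B₂ : ℤ → Submodule k M₂) (f : M₁ →ₗ[k] M₂) : Prop :=
  (∀ n : ℤ, ∀ x ∈ Z₁ n, f x ∈ Z₂ n) ∧ (∀ n : ℤ, ∀ x ∈ B₁ n, f x ∈ B₂ n) ∧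
  ∀ n : ℤ, (∀ z ∈ Z₂ n, ∃ w ∈ Z₁ n, f w - z ∈ B₂ n) ∧
    (∀ w ∈ Z₁ n, f w ∈ B₂ n → w ∈ B₁ n)

/-- Quasi-isomorphism of complexes, in elementary terms. -/
def QIsoData {M₁ M₂ : Type} [AddCommGroup M₁] [Module k M₁] [AddCommGroup M₂] [Module k M₂]
    (gm₁ : ℤ → Submodule k M₁) (D₁ : M₁ →ₗ[k] M₁)
    (gm₂ : ℤ → Submodule k M₂) (D₂ : M₂ →ₗ[k] M₂) (f : M₁ →ₗ[k] M₂) : Prop :=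
  InducesHIso (Zg gm₁ D₁) (Bg gm₁ D₁) (Zg gm₂ D₂) (Bg gm₂ D₂) f

/-- A morphism of DG modules is a quasi-isomorphism if it induces isomorphisms on
all cohomology groups. -/
def IsQuasiIso {X Y : DGMod A} (F : DGHom X Y) : Prop :=
  QIsoData X.gm X.D Y.gm Y.D F.f

/-- A DG module is acyclic if all its cohomology vanishes. -/
def AcyclicM (X : DGMod A) : Prop := ∀ n : ℤ, Zg X.gm X.D n ≤ Bg X.gm X.D n

/-- The `A`-submodule of a right DG module generated by a set. -/
def rSpan (X : DGMod A) (S : Set X.M) : Submodule k X.M :=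
  sInf {p : Submodule k X.M | S ⊆ ↑p ∧ ∀ (x : A.R) (m : X.M), m ∈ p → X.act x m ∈ p}

/-- Twisted modules: finitely generated semi-free right DG `A`-modules, i.e.
modules with a finite homogeneous basis `e` such that `D (e j)` lies in the
`A`-span of the previous basis elements ("strictly upper triangular" twisting). -/
def IsTwisted (T : DGMod A) : Prop :=
  ∃ (s : ℕ) (r : Fin s → ℤ) (e : Fin s → T.M),
    (∀ j, e j ∈ T.gm (-(r j))) ∧
    (∀ j, T.D (e j) ∈ rSpan T (e '' {i | i < j})) ∧
    Function.Bijective (fun v : Fin s → A.R => ∑ j, T.act (v j) (e j))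

/-- `P` is a homotopy direct summand of `T`. -/
def IsHoSummand (P T : DGMod A) : Prop :=
  ∃ (ι : DGHom P T) (ρ : DGHom T P), Homotopic (ρ.comp ι) (DGHom.id P)

/-- A perfect DG module: one admitting a resolution by a homotopy direct summand
of a twisted module. -/
def IsPerfect (N : DGMod A) : Prop :=
  ∃ T P : DGMod A, IsTwisted T ∧ IsHoSummand P T ∧ ∃ F : DGHom P N, IsQuasiIso F

/-- Homotopically projective (K-projective) DG modules. -/
def IsHoProjM (P : DGMod A) : Prop :=
  ∀ N : DGMod A, AcyclicM N → ∀ F : DGHom P N, Homotopic F (DGHom.zero P N)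

/-- Compactness of a DG algebra: the total cohomology is finite dimensional. -/
def IsCompactAlg (A : DGAlgebra k) : Prop :=
  (∀ n : ℤ, FiniteDimensional k (Hg A.gr A.d n)) ∧
    {n : ℤ | ¬ Subsingleton (Hg A.gr A.d n)}.Finite
/-- The grading operator on a graded module scaling the degree `j` component by `c j`. -/
def gop {M : Type} [AddCommGroup M] [Module k M]
    (gm : ℤ → Submodule k M) [DirectSum.Decomposition gm] (c : ℤ → k) : M →ₗ[k] M :=
  (DirectSum.toModule k ℤ M (fun j => c j • (gm j).subtype)) ∘ₗ
    (DirectSum.decomposeLinearEquiv gm).toLinearMap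

/-- A DG bimodule over `A` (equivalently, a right DG module over `Aᵉ = Aᵒᵖ ⊗ A`). -/
structure DGBimod (A : DGAlgebra k) : Type 1 where
  M : Type
  [acg : AddCommGroup M]
  [kmod : Module k M]
  gm : ℤ → Submodule k M
  [dec : DirectSum.Decomposition gm]
  actL : A.R →ₗ[k] M →ₗ[k] M
  actR : A.R →ₗ[k] M →ₗ[k] M
  actL_one : ∀ m : M, actL 1 m = m
  actR_one : ∀ m : M, actR 1 m = m
  actL_mul : ∀ (x y : A.R) (m : M), actL (x * y) m = actL x (actL y m)
  actR_mul : ∀ (x y : A.R) (m : M), actR (x * y) m = actR y (actR x m)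
  actLR : ∀ (x y : A.R) (m : M), actL x (actR y m) = actR y (actL x m)
  actL_deg : ∀ (i j : ℤ) (x : A.R) (m : M), x ∈ A.gr i → m ∈ gm j → actL x m ∈ gm (i + j)
  actR_deg : ∀ (i j : ℤ) (x : A.R) (m : M), x ∈ A.gr i → m ∈ gm j → actR x m ∈ gm (j + i)
  D : M →ₗ[k] M
  D_deg : ∀ (j : ℤ), ∀ m ∈ gm j, D m ∈ gm (j + 1)
  D_sq : ∀ m : M, D (D m) = 0
  leibnizL : ∀ (i j : ℤ) (x : A.R) (m : M), x ∈ A.gr i → m ∈ gm j →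
    D (actL x m) = actL (A.d x) m + sgnz i • actL x (D m)
  leibnizR : ∀ (i j : ℤ) (x : A.R) (m : M), x ∈ A.gr i → m ∈ gm j →
    D (actR x m) = actR x (D m) + sgnz j • actR (A.d x) m

attribute [instance] DGBimod.acg DGBimod.kmod DGBimod.dec

/-- Morphisms of DG bimodules (closed, degree 0). -/
structure BimodHom {A : DGAlgebra k} (X Y : DGBimod A) where
  f : X.M →ₗ[k] Y.M
  deg : ∀ (j : ℤ), ∀ m ∈ X.gm j, f m ∈ Y.gm j
  actLc : ∀ (x : A.R) (m : X.M), f (X.actL x m) = Y.actL x (f m)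
  actRc : ∀ (x : A.R) (m : X.M), f (X.actR x m) = Y.actR x (f m)
  comm : ∀ m : X.M, f (X.D m) = Y.D (f m)

def BimodHom.id (X : DGBimod A) : BimodHom X X :=
  ⟨LinearMap.id, fun _ _ h => h, fun _ _ => rfl, fun _ _ => rfl, fun _ => rfl⟩

def BimodHom.comp {X Y Z : DGBimod A} (G : BimodHom Y Z) (F : BimodHom X Y) : BimodHom X Z :=
  ⟨G.f ∘ₗ F.f, fun j m h => G.deg j _ (F.deg j m h),
    fun x m => by simp [LinearMap.comp_apply, F.actLc, G.actLc],
    fun x m => by simp [LinearMap.comp_apply, F.actRc, G.actRc],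
    fun m => by simp [LinearMap.comp_apply, F.comm, G.comm]⟩

def BimodHom.zero (X Y : DGBimod A) : BimodHom X Y :=
  ⟨0, fun j _ _ => (Y.gm j).zero_mem, fun _ _ => by simp, fun _ _ => by simp, fun _ => by simp⟩

/-- Chain homotopy between morphisms of DG bimodules (with the Koszul sign for the
left action). -/
def BimodHomotopic {X Y : DGBimod A} (F G : BimodHom X Y) : Prop :=
  ∃ h : X.M →ₗ[k] Y.M,
    (∀ (j : ℤ), ∀ m ∈ X.gm j, h m ∈ Y.gm (j - 1)) ∧
    (∀ (i : ℤ) (x : A.R), x ∈ A.gr i → ∀ m : X.M, h (X.actL x m) = sgnz i • Y.actL x (h m)) ∧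
    (∀ (x : A.R) (m : X.M), h (X.actR x m) = Y.actR x (h m)) ∧
    ∀ m : X.M, F.f m - G.f m = Y.D (h m) + h (X.D m)

def AcyclicB (X : DGBimod A) : Prop := ∀ n : ℤ, Zg X.gm X.D n ≤ Bg X.gm X.D n

def IsHoProjB (P : DGBimod A) : Prop :=
  ∀ N : DGBimod A, AcyclicB N → ∀ F : BimodHom P N, BimodHomotopic F (BimodHom.zero P N)

/-- Auxiliary: the action of a homogeneous element of degree `i` in the first tensor
factor of `Aᵉ` on a bimodule, with its Koszul sign. -/
def biactAux (N : DGBimod A) (i : ℤ) : ↥(A.gr i) →ₗ[k] A.R →ₗ[k] N.M →ₗ[k] N.M where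
  toFun x :=
    { toFun := fun y => (N.actL ↑x) ∘ₗ (N.actR y) ∘ₗ (gop N.gm fun j => sgnk k (i * j))
      map_add' := by intro y z; ext m; simp
      map_smul' := by intro c y; ext m; simp }
  map_add' := by intro x z; ext y m; simp [Submodule.coe_add]
  map_smul' := by intro c x; ext y m; simp

/-- The right action of `Aᵉ = Aᵒᵖ ⊗ A` (as a `k`-module, `A.R ⊗[k] A.R`) on a DG
bimodule, with Koszul signs. -/
def biact (N : DGBimod A) : (A.R ⊗[k] A.R) →ₗ[k] N.M →ₗ[k] N.M :=
  TensorProduct.lift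
    ((DirectSum.toModule k ℤ _ (fun i => biactAux N i)) ∘ₗ
      (DirectSum.decomposeLinearEquiv A.gr).toLinearMap)

/-- The sub-bimodule generated by a set. -/
def biSpan (N : DGBimod A) (S : Set N.M) : Submodule k N.M :=
  sInf {p : Submodule k N.M | S ⊆ ↑p ∧ (∀ (x : A.R) (m : N.M), m ∈ p → N.actL x m ∈ p) ∧
    ∀ (x : A.R) (m : N.M), m ∈ p → N.actR x m ∈ p}

/-- Twisted DG bimodules: finitely generated semi-free DG `Aᵉ`-modules. -/
def IsTwistedB (T : DGBimod A) : Prop :=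
  ∃ (s : ℕ) (r : Fin s → ℤ) (e : Fin s → T.M),
    (∀ j, e j ∈ T.gm (-(r j))) ∧
    (∀ j, T.D (e j) ∈ biSpan T (e '' {i | i < j})) ∧
    Function.Bijective (fun v : Fin s → A.R ⊗[k] A.R => ∑ j, biact T (v j) (e j))

def IsHoSummandB (P T : DGBimod A) : Prop :=
  ∃ (ι : BimodHom P T) (ρ : BimodHom T P), BimodHomotopic (ρ.comp ι) (BimodHom.id P)

def IsPerfectB (N : DGBimod A) : Prop :=
  ∃ T P : DGBimod A, IsTwistedB T ∧ IsHoSummandB P T ∧ ∃ F : BimodHom P N, QIsoData P.gm P.D N.gm N.D F.f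

/-- The diagonal bimodule: `A` as a DG bimodule over itself. -/
def diagBimod (A : DGAlgebra k) : DGBimod A where
  M := A.R
  gm := A.gr
  actL := LinearMap.mul k A.R
  actR := (LinearMap.mul k A.R).flip
  actL_one := fun m => one_mul m
  actR_one := fun m => mul_one m
  actL_mul := fun x y m => mul_assoc x y m
  actR_mul := fun x y m => (mul_assoc m x y).symm
  actLR := fun x y m => (mul_assoc x m y).symm
  actL_deg := fun i j x m hx hm => A.mul_mem hx hm
  actR_deg := fun i j x m hx hm => A.mul_mem hm hx
  D := A.d
  D_deg := A.d_deg
  D_sq := A.d_sq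
  leibnizL := fun i j x m hx _ => A.leibniz i x hx m
  leibnizR := fun i j x m _ hm => A.leibniz j m hm x

/-- `A` is homologically smooth if the diagonal bimodule is perfect over `Aᵉ`. -/
def IsSmooth (A : DGAlgebra k) : Prop := IsPerfectB (diagBimod A)

/-- The graded commutator subspace `[A, P] ⊆ P` of a DG bimodule. -/
def commSub (P : DGBimod A) : Submodule k P.M :=
  Submodule.span k {z : P.M | ∃ (i j : ℤ) (x : A.R) (m : P.M), x ∈ A.gr i ∧ m ∈ P.gm j ∧
    z = P.actL x m - sgnz (i * j) • P.actR x m}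

/-- Degree-`n` cycles of the complex `P/[A,P]` (computing `P ⊗_{Aᵉ} A`), described by
representatives in `P`. -/
def HHZ (P : DGBimod A) (n : ℤ) : Submodule k P.M :=
  P.gm n ⊓ (commSub P).comap P.D

/-- Degree-`n` boundaries of the complex `P/[A,P]`, described by representatives. -/
def HHB (P : DGBimod A) (n : ℤ) : Submodule k P.M :=
  P.gm n ⊓ (commSub P ⊔ LinearMap.range P.D)

/-- The `n`-th Hochschild homology group `HH_n(A) = H^n(P ⊗_{Aᵉ} A)` computed from a
bimodule resolution `P` of the diagonal. -/
def HHspace (P : DGBimod A) (n : ℤ) : Type :=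
  ↥(HHZ P n) ⧸ (Submodule.comap (HHZ P n).subtype (HHB P n ⊓ HHZ P n))

instance (P : DGBimod A) (n : ℤ) : AddCommGroup (HHspace P n) := by
  unfold HHspace; infer_instance

instance (P : DGBimod A) (n : ℤ) : Module k (HHspace P n) := by
  unfold HHspace; infer_instance

/-- `F : P → A` is an h-projective bimodule resolution of the diagonal bimodule. -/
def IsDiagResolution {A : DGAlgebra k} (P : DGBimod A) (F : BimodHom P (diagBimod A)) : Prop :=
  IsHoProjB P ∧ QIsoData P.gm P.D (diagBimod A).gm (diagBimod A).D F.f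
/-! ### Hom complexes and Ext spaces -/

/-- The degree-`n` part of the Hom complex of two right DG `A`-modules:
`A`-linear maps shifting degrees by `n`. -/
def homGrade (X Y : DGMod A) (n : ℤ) : Submodule k (X.M →ₗ[k] Y.M) where
  carrier := {f | (∀ (j : ℤ), ∀ m ∈ X.gm j, f m ∈ Y.gm (j + n)) ∧
    ∀ (x : A.R) (m : X.M), f (X.act x m) = Y.act x (f m)}
  add_mem' := by
    rintro f g ⟨hf1, hf2⟩ ⟨hg1, hg2⟩
    refine ⟨fun j m hm => ?_, fun x m => ?_⟩
    · exact (Y.gm (j + n)).add_mem (hf1 j m hm) (hg1 j m hm)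
    · simp [hf2, hg2]
  zero_mem' := by
    refine ⟨fun j m hm => (Y.gm (j + n)).zero_mem, fun x m => by simp⟩
  smul_mem' := by
    rintro c f ⟨hf1, hf2⟩
    refine ⟨fun j m hm => (Y.gm (j + n)).smul_mem c (hf1 j m hm), fun x m => ?_⟩
    simp [hf2]

theorem mem_homGrade {X Y : DGMod A} {n : ℤ} {f : X.M →ₗ[k] Y.M} :
    f ∈ homGrade X Y n ↔ ((∀ (j : ℤ), ∀ m ∈ X.gm j, f m ∈ Y.gm (j + n)) ∧
      ∀ (x : A.R) (m : X.M), f (X.act x m) = Y.act x (f m)) := Iff.rfl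

/-- The differential of the Hom complex in degree `n`:
`f ↦ D_Y ∘ f - (-1)^n f ∘ D_X`. -/
def homDop (X Y : DGMod A) (n : ℤ) : (X.M →ₗ[k] Y.M) →ₗ[k] (X.M →ₗ[k] Y.M) :=
  (LinearMap.llcomp k X.M Y.M Y.M) Y.D - sgnz n • (LinearMap.llcomp k X.M X.M Y.M).flip X.D

/-- Closed degree-`n` `A`-linear maps. -/
def ZHomS (X Y : DGMod A) (n : ℤ) : Submodule k (X.M →ₗ[k] Y.M) :=
  homGrade X Y n ⊓ LinearMap.ker (homDop X Y n)

/-- Degree-`n` boundaries of the Hom complex. -/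
def BHomS (X Y : DGMod A) (n : ℤ) : Submodule k (X.M →ₗ[k] Y.M) :=
  Submodule.map (homDop X Y (n - 1)) (homGrade X Y (n - 1))

/-- `Hom_{Ho(A)}(X, Y[n])`: the `n`-th cohomology of the Hom complex.  For
homotopically projective `X` this computes `Hom_{D(A)}(X, Y[n])`. -/
def ExtSpace (X Y : DGMod A) (n : ℤ) : Type :=
  ↥(ZHomS X Y n) ⧸ (Submodule.comap (ZHomS X Y n).subtype (BHomS X Y n ⊓ ZHomS X Y n))

instance (X Y : DGMod A) (n : ℤ) : AddCommGroup (ExtSpace X Y n) := by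
  unfold ExtSpace; infer_instance

instance (X Y : DGMod A) (n : ℤ) : Module k (ExtSpace X Y n) := by
  unfold ExtSpace; infer_instance

/-! ### Shifts, cones, isomorphisms in the homotopy category -/

/-- `X'` realizes the shift `X[t]` (so `X'^n = X^{n+t}`). -/
def IsShiftOf (X X' : DGMod A) (t : ℤ) : Prop :=
  ∃ g : X.M ≃ₗ[k] X'.M,
    (∀ n : ℤ, ∀ m ∈ X.gm (n + t), g m ∈ X'.gm n) ∧
    (∀ (x : A.R) (m : X.M), g (X.act x m) = X'.act x (g m)) ∧
    ∀ m : X.M, g (X.D m) = sgnz t • X'.D (g m)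

/-- `C` realizes the cone of the closed morphism `F : X → Y` with canonical
inclusion `j : Y → C`. -/
def IsConeOf {X Y : DGMod A} (F : DGHom X Y) (C : DGMod A) (j : DGHom Y C) : Prop :=
  ∃ (p : C.M →ₗ[k] X.M) (s : X.M →ₗ[k] C.M) (q : C.M →ₗ[k] Y.M),
    (∀ n : ℤ, ∀ c ∈ C.gm n, p c ∈ X.gm (n + 1)) ∧
    (∀ n : ℤ, ∀ m ∈ X.gm (n + 1), s m ∈ C.gm n) ∧
    (∀ n : ℤ, ∀ c ∈ C.gm n, q c ∈ Y.gm n) ∧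
    (∀ (x : A.R) (c : C.M), p (C.act x c) = X.act x (p c)) ∧
    (∀ (x : A.R) (m : X.M), s (X.act x m) = C.act x (s m)) ∧
    (∀ (x : A.R) (c : C.M), q (C.act x c) = Y.act x (q c)) ∧
    (∀ y : Y.M, q (j.f y) = y) ∧ (∀ m : X.M, p (s m) = m) ∧
    (∀ m : X.M, q (s m) = 0) ∧ (∀ y : Y.M, p (j.f y) = 0) ∧
    (∀ c : C.M, j.f (q c) + s (p c) = c) ∧
    ∀ m : X.M, C.D (s m) = j.f (F.f m) - s (X.D m)

/-- Isomorphism in the homotopy category of DG modules. -/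
def HoIso (X Y : DGMod A) : Prop :=
  ∃ (F : DGHom X Y) (G : DGHom Y X),
    Homotopic (G.comp F) (DGHom.id X) ∧ Homotopic (F.comp G) (DGHom.id Y)
/-! ### Left DG modules (right modules over `Aᵒᵖ`) and duality complexes -/

/-- A left DG module over `A` (equivalently, a right DG module over `Aᵒᵖ`). -/
structure DGModL (A : DGAlgebra k) : Type 1 where
  M : Type
  [acg : AddCommGroup M]
  [kmod : Module k M]
  gm : ℤ → Submodule k M
  [dec : DirectSum.Decomposition gm]
  actL : A.R →ₗ[k] M →ₗ[k] M
  actL_one : ∀ m : M, actL 1 m = m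
  actL_mul : ∀ (x y : A.R) (m : M), actL (x * y) m = actL x (actL y m)
  actL_deg : ∀ (i j : ℤ) (x : A.R) (m : M), x ∈ A.gr i → m ∈ gm j → actL x m ∈ gm (i + j)
  D : M →ₗ[k] M
  D_deg : ∀ (j : ℤ), ∀ m ∈ gm j, D m ∈ gm (j + 1)
  D_sq : ∀ m : M, D (D m) = 0
  leibnizL : ∀ (i j : ℤ) (x : A.R) (m : M), x ∈ A.gr i → m ∈ gm j →
    D (actL x m) = actL (A.d x) m + sgnz i • actL x (D m)

attribute [instance] DGModL.acg DGModL.kmod DGModL.dec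

/-- Morphisms of left DG modules. -/
structure DGHomL (X Y : DGModL A) where
  f : X.M →ₗ[k] Y.M
  deg : ∀ (j : ℤ), ∀ m ∈ X.gm j, f m ∈ Y.gm j
  actc : ∀ (x : A.R) (m : X.M), f (X.actL x m) = Y.actL x (f m)
  comm : ∀ m : X.M, f (X.D m) = Y.D (f m)

def DGHomL.id (X : DGModL A) : DGHomL X X :=
  ⟨LinearMap.id, fun _ _ h => h, fun _ _ => rfl, fun _ => rfl⟩

def DGHomL.comp {X Y Z : DGModL A} (G : DGHomL Y Z) (F : DGHomL X Y) : DGHomL X Z :=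
  ⟨G.f ∘ₗ F.f, fun j m h => G.deg j _ (F.deg j m h),
    fun x m => by simp [LinearMap.comp_apply, F.actc, G.actc],
    fun m => by simp [LinearMap.comp_apply, F.comm, G.comm]⟩

def HomotopicL {X Y : DGModL A} (F G : DGHomL X Y) : Prop :=
  ∃ h : X.M →ₗ[k] Y.M,
    (∀ (j : ℤ), ∀ m ∈ X.gm j, h m ∈ Y.gm (j - 1)) ∧
    (∀ (i : ℤ) (x : A.R), x ∈ A.gr i → ∀ m : X.M, h (X.actL x m) = sgnz i • Y.actL x (h m)) ∧
    ∀ m : X.M, F.f m - G.f m = Y.D (h m) + h (X.D m)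

def lSpan (X : DGModL A) (S : Set X.M) : Submodule k X.M :=
  sInf {p : Submodule k X.M | S ⊆ ↑p ∧ ∀ (x : A.R) (m : X.M), m ∈ p → X.actL x m ∈ p}

def IsTwistedL (T : DGModL A) : Prop :=
  ∃ (s : ℕ) (r : Fin s → ℤ) (e : Fin s → T.M),
    (∀ j, e j ∈ T.gm (-(r j))) ∧
    (∀ j, T.D (e j) ∈ lSpan T (e '' {i | i < j})) ∧
    Function.Bijective (fun v : Fin s → A.R => ∑ j, T.actL (v j) (e j))

def IsHoSummandL (P T : DGModL A) : Prop :=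
  ∃ (ι : DGHomL P T) (ρ : DGHomL T P), HomotopicL (ρ.comp ι) (DGHomL.id P)

def IsPerfectL (N : DGModL A) : Prop :=
  ∃ T P : DGModL A, IsTwistedL T ∧ IsHoSummandL P T ∧
    ∃ F : DGHomL P N, QIsoData P.gm P.D N.gm N.D F.f

/-- The degree-`n` part of the complex `Hom_A(X, A)` of right `A`-module maps into `A`. -/
def rHomGrade (X : DGMod A) (n : ℤ) : Submodule k (X.M →ₗ[k] A.R) where
  carrier := {g | (∀ (j : ℤ), ∀ m ∈ X.gm j, g m ∈ A.gr (j + n)) ∧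
    ∀ (x : A.R) (m : X.M), g (X.act x m) = g m * x}
  add_mem' := by
    rintro f g ⟨hf1, hf2⟩ ⟨hg1, hg2⟩
    exact ⟨fun j m hm => (A.gr (j + n)).add_mem (hf1 j m hm) (hg1 j m hm),
      fun x m => by simp [hf2, hg2, add_mul]⟩
  zero_mem' := ⟨fun j m hm => (A.gr (j + n)).zero_mem, fun x m => by simp⟩
  smul_mem' := by
    rintro c f ⟨hf1, hf2⟩
    exact ⟨fun j m hm => (A.gr (j + n)).smul_mem c (hf1 j m hm),
      fun x m => by simp [hf2, Algebra.smul_mul_assoc]⟩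

/-- `V` realizes the dual complex `X^∨ = RHom_A(X, A)` of a (homotopically projective)
right DG module `X`, as a left DG module. -/
def IsRightDualVia (X : DGMod A) (V : DGModL A)
    (Φ : V.M →ₗ[k] (X.M →ₗ[k] A.R)) : Prop :=
    Function.Injective Φ ∧
    (∀ n : ℤ, Submodule.map Φ (V.gm n) = rHomGrade X n) ∧
    (∀ (n : ℤ), ∀ v ∈ V.gm n, Φ (V.D v) = A.d ∘ₗ Φ v - sgnz n • (Φ v ∘ₗ X.D)) ∧
    ∀ (x : A.R) (v : V.M), Φ (V.actL x v) = LinearMap.mul k A.R x ∘ₗ Φ v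

def IsRightDualOf (X : DGMod A) (V : DGModL A) : Prop :=
  ∃ Φ, IsRightDualVia X V Φ

/-- The degree-`n` part of the complex `Hom_{Aᵒᵖ}(V, A)` of left `A`-module maps into `A`
(with Koszul signs for moving a degree-`n` map past a left action). -/
def lHomGrade (V : DGModL A) (n : ℤ) : Submodule k (V.M →ₗ[k] A.R) where
  carrier := {g | (∀ (j : ℤ), ∀ v ∈ V.gm j, g v ∈ A.gr (j + n)) ∧
    ∀ (i : ℤ) (x : A.R), x ∈ A.gr i → ∀ v : V.M, g (V.actL x v) = sgnz (i * n) • (x * g v)}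
  add_mem' := by
    rintro f g ⟨hf1, hf2⟩ ⟨hg1, hg2⟩
    exact ⟨fun j v hv => (A.gr (j + n)).add_mem (hf1 j v hv) (hg1 j v hv),
      fun i x hx v => by simp [hf2 i x hx, hg2 i x hx, mul_add, smul_add]⟩
  zero_mem' := ⟨fun j v hv => (A.gr (j + n)).zero_mem, fun i x hx v => by simp⟩
  smul_mem' := by
    rintro c f ⟨hf1, hf2⟩
    refine ⟨fun j v hv => (A.gr (j + n)).smul_mem c (hf1 j v hv), fun i x hx v => ?_⟩
    simp only [LinearMap.smul_apply, hf2 i x hx, Algebra.mul_smul_comm]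
    rw [smul_comm]

/-- `W` realizes the bidual complex `Hom_{Aᵒᵖ}(V, A)` of a left DG module `V`,
as a right DG module. -/
def IsLeftDualVia (V : DGModL A) (W : DGMod A)
    (Ψ : W.M →ₗ[k] (V.M →ₗ[k] A.R)) : Prop :=
    Function.Injective Ψ ∧
    (∀ n : ℤ, Submodule.map Ψ (W.gm n) = lHomGrade V n) ∧
    (∀ (n : ℤ), ∀ w ∈ W.gm n, Ψ (W.D w) = A.d ∘ₗ Ψ w - sgnz n • (Ψ w ∘ₗ V.D)) ∧
    ∀ (x : A.R) (w : W.M), Ψ (W.act x w) = (LinearMap.mul k A.R).flip x ∘ₗ Ψ w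

def IsLeftDualOf (V : DGModL A) (W : DGMod A) : Prop :=
  ∃ Ψ, IsLeftDualVia V W Ψ

/-- The degree-`j` part of the graded `k`-linear dual of a graded module:
functionals vanishing on all components of degree `≠ -j`. -/
def dualGrade {M : Type} [AddCommGroup M] [Module k M]
    (gm : ℤ → Submodule k M) (j : ℤ) : Submodule k (M →ₗ[k] k) where
  carrier := {ν | ∀ l : ℤ, l ≠ -j → ∀ m ∈ gm l, ν m = 0}
  add_mem' := by
    intro f g hf hg l hl m hm
    simp [hf l hl m hm, hg l hl m hm]
  zero_mem' := by intro l hl m hm; simp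
  smul_mem' := by
    intro c f hf l hl m hm
    simp [hf l hl m hm]

/-- `W` realizes the graded `k`-linear dual of a left DG module `V`, as a right DG
module (the Nakayama construction `V ↦ V^*`). -/
def IsGradedKDual (V : DGModL A) (W : DGMod A) : Prop :=
  ∃ Ψ : W.M →ₗ[k] (V.M →ₗ[k] k),
    (∀ (n : ℤ), ∀ w ∈ W.gm n, Ψ w ∈ dualGrade V.gm n) ∧
    (∀ n : ℤ, Function.Bijective
      (fun w : ↥(W.gm n) => (Ψ ↑w) ∘ₗ (V.gm (-n)).subtype)) ∧
    (∀ (n : ℤ), ∀ w ∈ W.gm n, ∀ v : V.M, Ψ (W.D w) v = -(sgnz n) • Ψ w (V.D v)) ∧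
    ∀ (i : ℤ) (x : A.R), x ∈ A.gr i → ∀ (n : ℤ), ∀ w ∈ W.gm n, ∀ v : V.M,
      Ψ (W.act x w) v = sgnz (i * n) • Ψ w (V.actL x v)

/-- `W` realizes the Nakayama functor value `S_A(X) = (X^∨)^*`. -/
def IsNakayamaOf (X : DGMod A) (W : DGMod A) : Prop :=
  ∃ V : DGModL A, IsRightDualOf X V ∧ IsGradedKDual V W
/-! ### Graded tensor products, dual complexes, and bimodule Hom complexes -/

/-- The degree-`n` part of the tensor product of two graded modules. -/
def tenGrade {M₁ M₂ : Type} [AddCommGroup M₁] [Module k M₁] [AddCommGroup M₂] [Module k M₂]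
    (gm₁ : ℤ → Submodule k M₁) (gm₂ : ℤ → Submodule k M₂) (n : ℤ) :
    Submodule k (M₁ ⊗[k] M₂) :=
  Submodule.span k {t : M₁ ⊗[k] M₂ | ∃ (i j : ℤ) (x : M₁) (y : M₂),
    x ∈ gm₁ i ∧ y ∈ gm₂ j ∧ i + j = n ∧ t = x ⊗ₜ y}

/-- The differential `D₁ ⊗ 1 + σ₁ ⊗ D₂` on a tensor product of complexes, where `σ₁`
is the sign operator of the first factor. -/
def tenD {M₁ M₂ : Type} [AddCommGroup M₁] [Module k M₁] [AddCommGroup M₂] [Module k M₂]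
    (D₁ : M₁ →ₗ[k] M₁) (s₁ : M₁ →ₗ[k] M₁) (D₂ : M₂ →ₗ[k] M₂) :
    (M₁ ⊗[k] M₂) →ₗ[k] (M₁ ⊗[k] M₂) :=
  TensorProduct.map D₁ LinearMap.id + TensorProduct.map s₁ D₂

/-- Cycles of a quotient complex `M/K`, described by representatives in `M`. -/
def ZgK {M : Type} [AddCommGroup M] [Module k M]
    (gm : ℤ → Submodule k M) (Dm : M →ₗ[k] M) (K : Submodule k M) (n : ℤ) :
    Submodule k M :=
  gm n ⊓ K.comap Dm

/-- Boundaries of a quotient complex `M/K`, described by representatives in `M`. -/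
def BgK {M : Type} [AddCommGroup M] [Module k M]
    (gm : ℤ → Submodule k M) (Dm : M →ₗ[k] M) (K : Submodule k M) (n : ℤ) :
    Submodule k M :=
  gm n ⊓ (K ⊔ LinearMap.range Dm)

/-- The differential of the graded dual of a complex. -/
def dualD {M : Type} [AddCommGroup M] [Module k M]
    (gm : ℤ → Submodule k M) [DirectSum.Decomposition gm] (Dm : M →ₗ[k] M) :
    (M →ₗ[k] k) →ₗ[k] (M →ₗ[k] k) :=
  -((LinearMap.llcomp k M M k).flip (Dm ∘ₗ gop gm fun j => sgnk k (j + 1)))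

/-- The left `A`-action on the dual `M^*` of a right DG `A`-module `M`. -/
def dualActL (M : DGMod A) (x : A.R) : (M.M →ₗ[k] k) →ₗ[k] (M.M →ₗ[k] k) :=
  (LinearMap.llcomp k M.M M.M k).flip (M.act x)

/-- The relations submodule defining `X ⊗_A V` inside `X ⊗_k V` for a right module `X`
and a bimodule `V`. -/
def tenRelMB (X : DGMod A) (V : DGBimod A) : Submodule k (X.M ⊗[k] V.M) :=
  Submodule.span k {t : X.M ⊗[k] V.M | ∃ (a : A.R) (x : X.M) (v : V.M),
    t = (X.act a x) ⊗ₜ v - x ⊗ₜ (V.actL a v)}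

/-- The relations submodule defining `U ⊗_A V` inside `U ⊗_k V` for two bimodules. -/
def tenRelBB (U V : DGBimod A) : Submodule k (U.M ⊗[k] V.M) :=
  Submodule.span k {t : U.M ⊗[k] V.M | ∃ (a : A.R) (u : U.M) (v : V.M),
    t = (U.actR a u) ⊗ₜ v - u ⊗ₜ (V.actL a v)}

/-- `V` realizes the dual bimodule `A^* = Hom_k(A, k)` (with its canonical DG
`A`-bimodule structure induced from the diagonal bimodule `A`). -/
def IsDualDiagOf {A : DGAlgebra k} (V : DGBimod A) : Prop :=
  ∃ Ψ : V.M →ₗ[k] (A.R →ₗ[k] k),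
    (∀ (n : ℤ), ∀ v ∈ V.gm n, Ψ v ∈ dualGrade A.gr n) ∧
    (∀ n : ℤ, Function.Bijective
      (fun v : ↥(V.gm n) => (Ψ ↑v) ∘ₗ (A.gr (-n)).subtype)) ∧
    (∀ (n : ℤ), ∀ v ∈ V.gm n, ∀ b : A.R, Ψ (V.D v) b = -(sgnz n) • Ψ v (A.d b)) ∧
    (∀ (i : ℤ) (x : A.R), x ∈ A.gr i → ∀ (n : ℤ), ∀ v ∈ V.gm n, ∀ b : A.R,
      Ψ (V.actL x v) b = sgnz (i * n) • Ψ v (b * x)) ∧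
    ∀ (x : A.R) (v : V.M) (b : A.R), Ψ (V.actR x v) b = Ψ v (x * b)

/-- The degree-`n` part of the bimodule Hom complex `Hom_{Aᵉ}(P, T)`, for a target
complex `T` equipped with (degreewise) commuting `Aᵉ`-actions `actLT`, `actRT`. -/
def bheGrade (P : DGBimod A) {T : Type} [AddCommGroup T] [Module k T]
    (gmT : ℤ → Submodule k T) (actLT actRT : ℤ → A.R → T →ₗ[k] T) (n : ℤ) :
    Submodule k (P.M →ₗ[k] T) where
  carrier := {g | (∀ (j : ℤ), ∀ m ∈ P.gm j, g m ∈ gmT (j + n)) ∧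
    (∀ (i : ℤ) (x : A.R), x ∈ A.gr i → ∀ m : P.M,
      g (P.actL x m) = sgnz (i * n) • actLT i x (g m)) ∧
    ∀ (i : ℤ) (x : A.R), x ∈ A.gr i → ∀ m : P.M, g (P.actR x m) = actRT i x (g m)}
  add_mem' := by
    rintro f g ⟨hf1, hf2, hf3⟩ ⟨hg1, hg2, hg3⟩
    exact ⟨fun j m hm => (gmT (j + n)).add_mem (hf1 j m hm) (hg1 j m hm),
      fun i x hx m => by simp [hf2 i x hx, hg2 i x hx, smul_add],
      fun i x hx m => by simp [hf3 i x hx, hg3 i x hx]⟩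
  zero_mem' := ⟨fun j m hm => (gmT (j + n)).zero_mem,
    fun i x hx m => by simp, fun i x hx m => by simp⟩
  smul_mem' := by
    rintro c f ⟨hf1, hf2, hf3⟩
    refine ⟨fun j m hm => (gmT (j + n)).smul_mem c (hf1 j m hm), fun i x hx m => ?_,
      fun i x hx m => by simp [hf3 i x hx]⟩
    simp only [LinearMap.smul_apply, hf2 i x hx, map_smul]
    rw [smul_comm]

/-- The differential of the bimodule Hom complex in degree `n`. -/
def bhDop (P : DGBimod A) {T : Type} [AddCommGroup T] [Module k T]
    (DT : T →ₗ[k] T) (n : ℤ) : (P.M →ₗ[k] T) →ₗ[k] (P.M →ₗ[k] T) :=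
  (LinearMap.llcomp k P.M T T) DT - sgnz n • (LinearMap.llcomp k P.M P.M T).flip P.D

/-- Closed degree-`n` elements of the bimodule Hom complex. -/
def ZbhS (P : DGBimod A) {T : Type} [AddCommGroup T] [Module k T]
    (gmT : ℤ → Submodule k T) (actLT actRT : ℤ → A.R → T →ₗ[k] T)
    (DT : T →ₗ[k] T) (n : ℤ) : Submodule k (P.M →ₗ[k] T) :=
  bheGrade P gmT actLT actRT n ⊓ LinearMap.ker (bhDop P DT n)

/-- Boundaries of degree `n` of the bimodule Hom complex. -/
def BbhS (P : DGBimod A) {T : Type} [AddCommGroup T] [Module k T]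
    (gmT : ℤ → Submodule k T) (actLT actRT : ℤ → A.R → T →ₗ[k] T)
    (DT : T →ₗ[k] T) (n : ℤ) : Submodule k (P.M →ₗ[k] T) :=
  Submodule.map (bhDop P DT (n - 1)) (bheGrade P gmT actLT actRT (n - 1))

/-- Cohomology of the bimodule Hom complex (`Ext` over `Aᵉ`). -/
def ExtBSpace (P : DGBimod A) {T : Type} [AddCommGroup T] [Module k T]
    (gmT : ℤ → Submodule k T) (actLT actRT : ℤ → A.R → T →ₗ[k] T)
    (DT : T →ₗ[k] T) (n : ℤ) : Type :=
  ↥(ZbhS P gmT actLT actRT DT n) ⧸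
    (Submodule.comap (ZbhS P gmT actLT actRT DT n).subtype
      (BbhS P gmT actLT actRT DT n ⊓ ZbhS P gmT actLT actRT DT n))

instance (P : DGBimod A) {T : Type} [AddCommGroup T] [Module k T]
    (gmT : ℤ → Submodule k T) (actLT actRT : ℤ → A.R → T →ₗ[k] T)
    (DT : T →ₗ[k] T) (n : ℤ) : AddCommGroup (ExtBSpace P gmT actLT actRT DT n) := by
  unfold ExtBSpace; infer_instance

instance (P : DGBimod A) {T : Type} [AddCommGroup T] [Module k T]
    (gmT : ℤ → Submodule k T) (actLT actRT : ℤ → A.R → T →ₗ[k] T)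
    (DT : T →ₗ[k] T) (n : ℤ) : Module k (ExtBSpace P gmT actLT actRT DT n) := by
  unfold ExtBSpace; infer_instance

/-- The differential of `Aᵉ` on the underlying space `A.R ⊗[k] A.R`. -/
def aeD (A : DGAlgebra k) : (A.R ⊗[k] A.R) →ₗ[k] (A.R ⊗[k] A.R) :=
  tenD A.d (gop A.gr fun j => sgnk k j) A.d

/-- The inner (module) action of a homogeneous element of degree `i` on the left slot
of the free `Aᵉ`-module `Aᵉ`. -/
def aeInnerL (A : DGAlgebra k) (i : ℤ) (x : A.R) : (A.R ⊗[k] A.R) →ₗ[k] (A.R ⊗[k] A.R) :=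
  TensorProduct.map (LinearMap.mulLeft k x) (gop A.gr fun j => sgnk k (i * j))

/-- The inner (module) action on the right slot of the free `Aᵉ`-module `Aᵉ`. -/
def aeInnerR (A : DGAlgebra k) (i : ℤ) (x : A.R) : (A.R ⊗[k] A.R) →ₗ[k] (A.R ⊗[k] A.R) :=
  TensorProduct.map LinearMap.id (LinearMap.mulRight k x)

/-- The outer left action on the free `Aᵉ`-module `Aᵉ`. -/
def aeOuterL (A : DGAlgebra k) (i : ℤ) (x : A.R) : (A.R ⊗[k] A.R) →ₗ[k] (A.R ⊗[k] A.R) :=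
  TensorProduct.map (LinearMap.mulRight k x) LinearMap.id

/-- The outer right action on the free `Aᵉ`-module `Aᵉ`. -/
def aeOuterR (A : DGAlgebra k) (i : ℤ) (x : A.R) : (A.R ⊗[k] A.R) →ₗ[k] (A.R ⊗[k] A.R) :=
  TensorProduct.map (gop A.gr fun j => sgnk k (i * j)) (LinearMap.mulLeft k x)

/-- `E` represents the inverse dualizing bimodule
`A^! = RHom_{(Aᵉ)ᵒᵖ}(A, (Aᵉ)ᵒᵖ)`: `E` is identified, via `Φ`, with the bimodule Hom
complex `Hom_{Aᵉ}(P, Aᵉ)` for an h-projective bimodule resolution `P` of the diagonal. -/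
def RepresentsShriek {A : DGAlgebra k} (E : DGBimod A) : Prop :=
  ∃ (P : DGBimod A) (F : BimodHom P (diagBimod A)), IsDiagResolution P F ∧
  ∃ Φ : E.M →ₗ[k] (P.M →ₗ[k] (A.R ⊗[k] A.R)),
    Function.Injective Φ ∧
    (∀ n : ℤ, Submodule.map Φ (E.gm n) =
      bheGrade P (tenGrade A.gr A.gr) (aeInnerL A) (aeInnerR A) n) ∧
    (∀ (n : ℤ), ∀ v ∈ E.gm n, Φ (E.D v) = bhDop P (aeD A) n (Φ v)) ∧
    (∀ (i : ℤ) (x : A.R), x ∈ A.gr i → ∀ v : E.M,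
      Φ (E.actL x v) = aeOuterL A i x ∘ₗ Φ v) ∧
    ∀ (i : ℤ) (x : A.R), x ∈ A.gr i → ∀ v : E.M,
      Φ (E.actR x v) = aeOuterR A i x ∘ₗ Φ v

/-- The relations submodule defining `M ⊗_A V` inside `M ⊗_k V` for a right module `M`
and a left module `V`. -/
def tenRelML (M : DGMod A) (V : DGModL A) : Submodule k (M.M ⊗[k] V.M) :=
  Submodule.span k {t : M.M ⊗[k] V.M | ∃ (a : A.R) (m : M.M) (v : V.M),
    t = (M.act a m) ⊗ₜ v - m ⊗ₜ (V.actL a v)}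

/-- `Z` is a biproduct of `X` and `Y` in the category of DG modules. -/
def IsBiproductOf (X Y Z : DGMod A) : Prop :=
  ∃ (i₁ : DGHom X Z) (i₂ : DGHom Y Z) (p₁ : DGHom Z X) (p₂ : DGHom Z Y),
    (∀ x, p₁.f (i₁.f x) = x) ∧ (∀ y, p₂.f (i₂.f y) = y) ∧
    (∀ x, p₂.f (i₁.f x) = 0) ∧ (∀ y, p₁.f (i₂.f y) = 0) ∧
    ∀ z, i₁.f (p₁.f z) + i₂.f (p₂.f z) = z

/-- Finite direct sums of shifts of objects of `S`. -/
inductive FinSumShift (S : Set (DGMod A)) : DGMod A → Prop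
  | base : ∀ (X X' : DGMod A) (t : ℤ), X ∈ S → IsShiftOf X X' t → FinSumShift S X'
  | pair : ∀ X Y Z : DGMod A, FinSumShift S X → FinSumShift S Y →
      IsBiproductOf X Y Z → FinSumShift S Z

/-- Closure of `S` under shifts, finite direct sums, and homotopy direct summands. -/
def addClosure (S : Set (DGMod A)) : Set (DGMod A) :=
  {X | ∃ Z : DGMod A, FinSumShift S Z ∧ IsHoSummand X Z}

/-- Objects arising as an extension (cone) with first vertex in `S` and third
vertex in `T[1]`. -/
def starSet (S T : Set (DGMod A)) : Set (DGMod A) :=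
  {C | ∃ (U V : DGMod A) (F : DGHom U V) (j : DGHom V C),
    IsConeOf F C j ∧ V ∈ S ∧ ∃ U₁ ∈ T, IsShiftOf U₁ U 1}

/-- The subcategory `⟨E⟩ₙ`: objects built from `E` by shifts, finite direct sums,
direct summands, and at most `n` cones (so `genLevel E 0 = ⟨E⟩₁`). -/
def genLevel (E : DGMod A) : ℕ → Set (DGMod A)
  | 0 => addClosure {E}
  | n + 1 => addClosure (starSet (genLevel E n) (addClosure {E}))


/-! ### Signs -/
theorem sgnz_add (i j : ℤ) : sgnz (i + j) = sgnz i * sgnz j := by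
  unfold sgnz
  by_cases hi : Even i <;> by_cases hj : Even j <;> simp [Int.even_add, hi, hj]

theorem sgnz_one : sgnz 1 = -1 := by
  unfold sgnz; simp

theorem sgnz_zero : sgnz 0 = 1 := by
  unfold sgnz; simp

theorem sgnz_add_one (i : ℤ) : sgnz (i + 1) = -sgnz i := by
  rw [sgnz_add, sgnz_one]; ring

theorem sgnz_mul_self (i : ℤ) : sgnz i * sgnz i = 1 := by
  unfold sgnz; split_ifs <;> simp

theorem sgnz_neg (i : ℤ) : sgnz (-i) = sgnz i := by
  unfold sgnz; simp

theorem sgnz_sub (i j : ℤ) : sgnz (i - j) = sgnz i * sgnz j := by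
  rw [sub_eq_add_neg, sgnz_add, sgnz_neg]

theorem sgnz_sub_one (i : ℤ) : sgnz (i - 1) = -sgnz i := by
  rw [sgnz_sub, sgnz_one]; ring

theorem sgnz_smul_smul {M : Type} [AddCommGroup M] (i : ℤ) (m : M) :
    sgnz i • sgnz i • m = m := by
  rw [smul_smul, sgnz_mul_self, one_smul]

theorem zsmul_mem' {M : Type} [AddCommGroup M] [Module k M] (p : Submodule k M) (z : ℤ) {m : M}
    (h : m ∈ p) : z • m ∈ p := p.toAddSubgroup.zsmul_mem h z

theorem sgnk_smul {M : Type} [AddCommGroup M] [Module k M] (i : ℤ) (m : M) :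
    sgnk k i • m = sgnz i • m := by
  unfold sgnk sgnz; split_ifs <;> simp

/-! ### Gradings -/
section gradings
variable {M : Type} [AddCommGroup M] [Module k M] (gm : ℤ → Submodule k M)

theorem hom_ind [DirectSum.Decomposition gm] {p : Submodule k M}
    (h : ∀ n, ∀ m ∈ gm n, m ∈ p) (m : M) : m ∈ p := by
  induction m using DirectSum.Decomposition.inductionOn gm with
  | zero => exact p.zero_mem
  | homogeneous m => exact h _ _ m.2
  | add m m' h1 h2 => exact p.add_mem h1 h2

theorem hom_ext {M' : Type} [AddCommGroup M'] [Module k M'] [DirectSum.Decomposition gm]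
    {f g : M →ₗ[k] M'}
    (h : ∀ n, ∀ m ∈ gm n, f m = g m) : f = g := by
  ext m
  have := hom_ind gm (p := LinearMap.eqLocus f g) (fun n m hm => h n m hm) m
  exact this

/-- assemble a linear map from its values on homogeneous elements -/
def asm [DirectSum.Decomposition gm] {M' : Type} [AddCommGroup M'] [Module k M']
    (f : ℤ → M →ₗ[k] M') : M →ₗ[k] M' :=
  (DirectSum.toModule k ℤ M' (fun j => f j ∘ₗ (gm j).subtype)) ∘ₗ
    (DirectSum.decomposeLinearEquiv gm).toLinearMap

theorem asm_apply [DirectSum.Decomposition gm] {M' : Type} [AddCommGroup M'] [Module k M']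
    (f : ℤ → M →ₗ[k] M') {n : ℤ} {m : M} (hm : m ∈ gm n) : asm gm f m = f n m := by
  unfold asm
  rw [LinearMap.comp_apply]
  have : (DirectSum.decomposeLinearEquiv gm).toLinearMap m = DirectSum.lof k ℤ (fun i => gm i) n ⟨m, hm⟩ := by
    exact DirectSum.decompose_of_mem gm hm
  rw [this, DirectSum.toModule_lof]
  rfl

theorem gop_eq [DirectSum.Decomposition gm] (c : ℤ → k) :
    gop gm c = asm gm (fun j => c j • LinearMap.id) := rfl

theorem gop_apply [DirectSum.Decomposition gm] (c : ℤ → k) {n : ℤ} {m : M} (hm : m ∈ gm n) :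
    gop gm c m = c n • m := by
  rw [gop_eq, asm_apply gm _ hm]; rfl

/-- projection onto the degree `n` component -/
def prj [DirectSum.Decomposition gm] (n : ℤ) : M →ₗ[k] M :=
  asm gm (fun j => if j = n then LinearMap.id else 0)

theorem prj_same [DirectSum.Decomposition gm] {n : ℤ} {m : M} (hm : m ∈ gm n) :
    prj gm n m = m := by
  unfold prj; rw [asm_apply gm _ hm]; simp

theorem prj_ne [DirectSum.Decomposition gm] {n n' : ℤ} {m : M} (hm : m ∈ gm n) (h : n ≠ n') :
    prj gm n' m = 0 := by
  unfold prj; rw [asm_apply gm _ hm]; simp [h]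

theorem prj_mem [DirectSum.Decomposition gm] (n : ℤ) (m : M) : prj gm n m ∈ gm n := by
  refine hom_ind gm (p := (gm n).comap (prj gm n)) (fun j m hm => ?_) m
  rw [Submodule.mem_comap]
  by_cases h : j = n
  · subst h; rw [prj_same gm hm]; exact hm
  · rw [prj_ne gm hm h]; exact (gm n).zero_mem

theorem eq_of_prj [DirectSum.Decomposition gm] {m : M} (h : ∀ n, prj gm n m = 0) : m = 0 := by
  have key : ∀ n, ((DirectSum.decompose gm m n : gm n) : M) = prj gm n m := by
    intro n
    have := hom_ext gm (f := (gm n).subtype ∘ₗ DirectSum.component k ℤ (fun i => gm i) n ∘ₗ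
      (DirectSum.decomposeLinearEquiv gm).toLinearMap) (g := prj gm n) (by
        intro j m hm
        by_cases hj : j = n
        · subst hj
          rw [prj_same gm hm]
          exact DirectSum.decompose_of_mem_same gm hm
        · rw [prj_ne gm hm hj]
          exact DirectSum.decompose_of_mem_ne gm hm hj)
    exact congrArg (fun f => f m) this
  apply (DirectSum.decompose gm).injective
  rw [DirectSum.decompose_zero]
  refine DFinsupp.ext fun n => Subtype.ext ?_
  rw [key, h]; rfl

/-- commuting a degree `c` map with projections -/
theorem prj_comm [DirectSum.Decomposition gm] {M' : Type} [AddCommGroup M'] [Module k M']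
    (gm' : ℤ → Submodule k M') [DirectSum.Decomposition gm'] (f : M →ₗ[k] M') (c : ℤ)
    (hf : ∀ n, ∀ m ∈ gm n, f m ∈ gm' (n + c)) (n n' : ℤ) (hn : n + c = n') (m : M) :
    prj gm' n' (f m) = f (prj gm n m) := by
  subst hn
  have := hom_ext gm (f := prj gm' (n + c) ∘ₗ f) (g := f ∘ₗ prj gm n) (by
    intro j m hm
    simp only [LinearMap.comp_apply]
    by_cases h : j = n
    · subst h; rw [prj_same gm hm, prj_same gm' (hf _ _ hm)]
    · rw [prj_ne gm hm h, prj_ne gm' (hf _ _ hm) (by omega), map_zero])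
  exact congrArg (fun f => f m) this

/-- make a decomposition from projections -/
@[reducible] def mkDec (p : ℤ → M →ₗ[k] M) (h1 : ∀ n, ∀ m ∈ gm n, p n m = m)
    (h2 : ∀ n n', n ≠ n' → ∀ m ∈ gm n, p n' m = 0) (h3 : ∀ m, m ∈ ⨆ n, gm n) :
    DirectSum.Decomposition gm := by
  refine DirectSum.IsInternal.chooseDecomposition (ℳ := gm)
    (DirectSum.isInternal_submodule_of_iSupIndep_of_iSup_eq_top ?_ ?_)
  · rw [iSupIndep_def]
    intro i
    rw [Submodule.disjoint_def]
    intro x hx hx'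
    have : (⨆ j, ⨆ (_ : j ≠ i), gm j) ≤ LinearMap.ker (p i) := by
      refine iSup₂_le fun j hj m hm => ?_
      exact h2 j i hj m hm
    have h := this hx'
    rw [LinearMap.mem_ker, h1 i x hx] at h
    exact h
  · exact Submodule.eq_top_iff'.2 h3

/-- homogenization of a linear map in degree `c` -/
def hg [DirectSum.Decomposition gm] {M' : Type} [AddCommGroup M'] [Module k M']
    (gm' : ℤ → Submodule k M') [DirectSum.Decomposition gm'] (c : ℤ) (f : M →ₗ[k] M') :
    M →ₗ[k] M' := asm gm (fun n => prj gm' (n + c) ∘ₗ f)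

theorem hg_apply [DirectSum.Decomposition gm] {M' : Type} [AddCommGroup M'] [Module k M']
    (gm' : ℤ → Submodule k M') [DirectSum.Decomposition gm'] (c : ℤ) (f : M →ₗ[k] M')
    {n : ℤ} {m : M} (hm : m ∈ gm n) : hg gm gm' c f m = prj gm' (n + c) (f m) := by
  unfold hg; rw [asm_apply gm _ hm]; rfl

end gradings

theorem DGMod.leib (X : DGMod A) {j : ℤ} {m : X.M} (hm : m ∈ X.gm j) (x : A.R) :
    X.D (X.act x m) = X.act x (X.D m) + sgnz j • X.act (A.d x) m := by
  have := hom_ext A.gr (f := X.D ∘ₗ X.act.flip m)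
    (g := X.act.flip (X.D m) + sgnz j • (X.act.flip m ∘ₗ A.d)) (by
      intro i x hx
      simpa using X.leibniz i j x m hx hm)
  simpa using congrArg (fun f => f x) this

/-! ### Homotopy basics -/
theorem Homotopic.refl' {X Y : DGMod A} (F : DGHom X Y) : Homotopic F F :=
  ⟨0, fun j m _ => (Y.gm _).zero_mem, by simp, by simp⟩

theorem Homotopic.symm' {X Y : DGMod A} {F G : DGHom X Y} (h : Homotopic F G) :
    Homotopic G F := by
  obtain ⟨h, h1, h2, h3⟩ := h
  refine ⟨-h, fun j m hm => (Y.gm _).neg_mem (h1 j m hm), fun x m => by simp [h2], fun m => ?_⟩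
  have := h3 m
  simp only [LinearMap.neg_apply, map_neg]
  rw [← neg_sub, this]; abel

theorem Homotopic.trans' {X Y : DGMod A} {F G H : DGHom X Y} (h : Homotopic F G)
    (h' : Homotopic G H) : Homotopic F H := by
  obtain ⟨h, h1, h2, h3⟩ := h
  obtain ⟨g, g1, g2, g3⟩ := h'
  refine ⟨h + g, fun j m hm => (Y.gm _).add_mem (h1 j m hm) (g1 j m hm),
    fun x m => by simp [h2, g2], fun m => ?_⟩
  simp only [LinearMap.add_apply, map_add]
  rw [← sub_add_sub_cancel _ (G.f m), h3, g3]; abel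

theorem Homotopic.compl {X Y Z : DGMod A} {F G : DGHom X Y} (h : Homotopic F G)
    (K : DGHom Y Z) : Homotopic (K.comp F) (K.comp G) := by
  obtain ⟨h, h1, h2, h3⟩ := h
  refine ⟨K.f ∘ₗ h, fun j m hm => K.deg _ _ (h1 j m hm),
    fun x m => by simp [h2, K.actc], fun m => ?_⟩
  simp only [LinearMap.comp_apply, DGHom.comp, ← map_sub, h3, map_add, K.comm]

theorem Homotopic.compr {X Y Z : DGMod A} {F G : DGHom Y Z} (h : Homotopic F G)
    (K : DGHom X Y) : Homotopic (F.comp K) (G.comp K) := by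
  obtain ⟨h, h1, h2, h3⟩ := h
  refine ⟨h ∘ₗ K.f, fun j m hm => h1 _ _ (K.deg j m hm),
    fun x m => by simp [h2, K.actc], fun m => ?_⟩
  simp only [LinearMap.comp_apply, DGHom.comp, h3, K.comm]

theorem IsHoSummand.refl' (X : DGMod A) : IsHoSummand X X :=
  ⟨DGHom.id X, DGHom.id X, Homotopic.refl' _⟩

theorem IsHoSummand.trans' {X Y Z : DGMod A} (h : IsHoSummand X Y) (h' : IsHoSummand Y Z) :
    IsHoSummand X Z := by
  obtain ⟨i, r, h⟩ := h
  obtain ⟨i', r', h'⟩ := h'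
  refine ⟨i'.comp i, r.comp r', Homotopic.trans' (G := r.comp i) ?_ h⟩
  exact (h'.compr i).compl r

theorem IsShiftOf.refl' (X : DGMod A) : IsShiftOf X X 0 :=
  ⟨LinearEquiv.refl k X.M, fun n m hm => by simpa using hm, fun _ _ => rfl,
    fun m => by simp [sgnz_zero]⟩

theorem mem_addClosure_of_mem {S : Set (DGMod A)} {X : DGMod A} (h : X ∈ S) : X ∈ addClosure S :=
  ⟨X, FinSumShift.base X X 0 h (IsShiftOf.refl' X), IsHoSummand.refl' X⟩

theorem addClosure_summand {S : Set (DGMod A)} {X Y : DGMod A} (h : Y ∈ addClosure S)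
    (h' : IsHoSummand X Y) : X ∈ addClosure S := by
  obtain ⟨Z, hZ, hY⟩ := h
  exact ⟨Z, hZ, h'.trans' hY⟩

theorem genLevel_summand {E X Y : DGMod A} {n : ℕ} (h : Y ∈ genLevel E n)
    (h' : IsHoSummand X Y) : X ∈ genLevel E n := by
  cases n with
  | zero => exact addClosure_summand h h'
  | succ n => exact addClosure_summand h h'

/-! ### Cones -/
/-- The cone of a morphism of DG modules. -/
@[reducible] def cone {X Y : DGMod A} (F : DGHom X Y) : DGMod A where
  M := X.M × Y.M
  gm n := (X.gm (n + 1)).prod (Y.gm n)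
  dec := mkDec _ (fun n => LinearMap.prodMap (prj X.gm (n + 1)) (prj Y.gm n))
    (by
      rintro n ⟨x, y⟩ ⟨hx, hy⟩
      simp only [LinearMap.prodMap_apply]
      rw [prj_same _ hx, prj_same _ hy])
    (by
      rintro n n' h ⟨x, y⟩ ⟨hx, hy⟩
      simp only [LinearMap.prodMap_apply]
      rw [prj_ne _ hx (by omega), prj_ne _ hy h]; rfl)
    (by
      rintro ⟨x, y⟩
      have h1 : ((x, 0) : X.M × Y.M) ∈ ⨆ n, (X.gm (n + 1)).prod (Y.gm n) := by
        refine hom_ind X.gm (p := Submodule.comap (LinearMap.inl k X.M Y.M)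
          (⨆ n, (X.gm (n + 1)).prod (Y.gm n))) (fun n m hm => ?_) x
        refine Submodule.mem_iSup_of_mem (n - 1) ⟨?_, (Y.gm _).zero_mem⟩
        simpa using hm
      have h2 : ((0, y) : X.M × Y.M) ∈ ⨆ n, (X.gm (n + 1)).prod (Y.gm n) := by
        refine hom_ind Y.gm (p := Submodule.comap (LinearMap.inr k X.M Y.M)
          (⨆ n, (X.gm (n + 1)).prod (Y.gm n))) (fun n m hm => ?_) y
        exact Submodule.mem_iSup_of_mem n ⟨(X.gm _).zero_mem, hm⟩
      have := Submodule.add_mem _ h1 h2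
      simpa using this)
  act := LinearMap.mk₂ k (fun x m => (X.act x m.1, Y.act x m.2))
    (by intros; simp) (by intros; simp) (by intros; simp) (by intros; simp)
  act_one m := by simp [X.act_one, Y.act_one]
  act_mul x y m := by simp [X.act_mul, Y.act_mul]
  act_deg i j x m hx hm := by
    refine ⟨?_, Y.act_deg i j x _ hx hm.2⟩
    have := X.act_deg i (j + 1) x _ hx hm.1
    rw [show j + i + 1 = j + 1 + i by ring]; exact this
  D := LinearMap.prod (-(X.D ∘ₗ LinearMap.fst k X.M Y.M))
    (F.f ∘ₗ LinearMap.fst k X.M Y.M + Y.D ∘ₗ LinearMap.snd k X.M Y.M)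
  D_deg j m hm := by
    refine ⟨(X.gm _).neg_mem (X.D_deg _ _ hm.1), (Y.gm _).add_mem (F.deg _ _ hm.1) (Y.D_deg _ _ hm.2)⟩
  D_sq m := by
    simp [X.D_sq, Y.D_sq, F.comm]
  leibniz i j x m hx hm := by
    have h1 := X.leib hm.1 x
    have h2 := Y.leib hm.2 x
    refine Prod.ext ?_ ?_
    · simp [h1, sgnz_add_one]; abel
    · simp [h2, F.actc]; abel

theorem cone_D {X Y : DGMod A} (F : DGHom X Y) (x : X.M) (y : Y.M) :
    (cone F).D (x, y) = (-X.D x, F.f x + Y.D y) := rfl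

theorem cone_act {X Y : DGMod A} (F : DGHom X Y) (a : A.R) (x : X.M) (y : Y.M) :
    (cone F).act a (x, y) = (X.act a x, Y.act a y) := rfl

/-- inclusion into the cone -/
def coneIncl {X Y : DGMod A} (F : DGHom X Y) : DGHom Y (cone F) :=
  ⟨LinearMap.inr k X.M Y.M, fun j m hm => ⟨(X.gm _).zero_mem, hm⟩,
    fun x m => by rw [LinearMap.inr_apply, LinearMap.inr_apply, cone_act, map_zero],
    fun m => by rw [LinearMap.inr_apply, LinearMap.inr_apply, cone_D, map_zero, map_zero]; simp⟩

theorem cone_isCone {X Y : DGMod A} (F : DGHom X Y) : IsConeOf F (cone F) (coneIncl F) := by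
  refine ⟨LinearMap.fst k X.M Y.M, LinearMap.inl k X.M Y.M, LinearMap.snd k X.M Y.M,
    fun n c hc => hc.1, fun n m hm => ⟨hm, (Y.gm _).zero_mem⟩, fun n c hc => hc.2,
    fun _ _ => rfl, fun x m => ?_, fun _ _ => rfl, fun _ => rfl, fun _ => rfl, fun _ => rfl,
    fun _ => rfl, fun c => ?_, fun m => ?_⟩
  · rw [LinearMap.inl_apply, LinearMap.inl_apply, cone_act, map_zero]
  · change ((0, c.2) : X.M × Y.M) + (c.1, 0) = c
    simp
  · rw [LinearMap.inl_apply, cone_D]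
    change ((_, _) : X.M × Y.M) = (0, F.f m) - (X.D m, 0)
    simp

theorem aux_neg {M : Type} [AddCommGroup M] {a b c m : M} (h : m = a + b + c) :
    a - m = -b + -c := by
  subst h; abel

/-- If the inclusion into a cone is null-homotopic then the target is a summand of the source. -/
theorem section_of_null {X Y : DGMod A} (F : DGHom X Y)
    (h : Homotopic (coneIncl F) (DGHom.zero Y (cone F))) :
    ∃ σ : DGHom Y X, Homotopic (F.comp σ) (DGHom.id Y) := by
  obtain ⟨h, h1, h2, h3⟩ := h
  have h3' : ∀ m, ((0, m) : X.M × Y.M) = (cone F).D (h m) + h (Y.D m) := by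
    intro m
    have := h3 m
    rw [← this]
    change _ = ((0, m) : X.M × Y.M) - 0
    simp
  have e1 : ∀ m, (0 : X.M) = -X.D (h m).1 + (h (Y.D m)).1 := fun m => congrArg Prod.fst (h3' m)
  have e2 : ∀ m, m = (F.f (h m).1 + Y.D (h m).2) + (h (Y.D m)).2 :=
    fun m => congrArg Prod.snd (h3' m)
  refine ⟨⟨LinearMap.fst k X.M Y.M ∘ₗ h, fun j m hm => ?_, fun x m => ?_, fun m => ?_⟩,
    ⟨-(LinearMap.snd k X.M Y.M ∘ₗ h), fun j m hm => ?_, fun x m => ?_, fun m => ?_⟩⟩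
  · have := (h1 j m hm).1
    rw [sub_add_cancel] at this; exact this
  · exact congrArg Prod.fst (h2 x m)
  · have := e1 m
    change (h (Y.D m)).1 = X.D (h m).1
    rw [eq_comm, neg_add_eq_zero] at this
    exact this.symm
  · exact (Y.gm _).neg_mem (h1 j m hm).2
  · have := congrArg Prod.snd (h2 x m)
    change -(h (Y.act x m)).2 = Y.act x (-(h m).2)
    rw [map_neg, this]; rfl
  · change F.f (h m).1 - m = Y.D (-(h m).2) + -(h (Y.D m)).2
    rw [map_neg]
    exact aux_neg (e2 m)


theorem summand_of_null {X Y : DGMod A} (F : DGHom X Y)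
    (h : Homotopic (coneIncl F) (DGHom.zero Y (cone F))) : IsHoSummand Y X := by
  obtain ⟨σ, hσ⟩ := section_of_null F h
  exact ⟨σ, F, hσ⟩

/-! ### Null-homotopies over the ground field -/
theorem lin_lift {U V W : Type} [AddCommGroup U] [Module k U] [AddCommGroup V] [Module k V]
    [AddCommGroup W] [Module k W] (α : V →ₗ[k] W) (β : U →ₗ[k] W)
    (h : ∀ u, ∃ v, α v = β u) : ∃ γ : U →ₗ[k] V, ∀ u, α (γ u) = β u := by
  have hr : ∀ u, β u ∈ LinearMap.range α := fun u => h u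
  obtain ⟨γ, hγ⟩ := Module.projective_lifting_property α.rangeRestrict
    (β.codRestrict (LinearMap.range α) hr) α.surjective_rangeRestrict
  refine ⟨γ, fun u => ?_⟩
  have := congrArg (fun f => ((f u : LinearMap.range α) : W)) hγ
  simpa using this

theorem null_k {K : Type} [AddCommGroup K] [Module k K] (gmK : ℤ → Submodule k K)
    [DirectSum.Decomposition gmK] (DK : K →ₗ[k] K)
    (Dd : ∀ n, ∀ t ∈ gmK n, DK t ∈ gmK (n + 1)) (Dsq : ∀ t, DK (DK t) = 0)
    {N N' : DGMod A} (g : DGHom N N')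
    (hgh : ∀ n, ∀ z ∈ N.gm n, N.D z = 0 → ∃ y, N'.D y = g.f z)
    (c : ℤ) (ψ : K →ₗ[k] N.M) (hψd : ∀ n, ∀ t ∈ gmK n, ψ t ∈ N.gm (n + c))
    (hψ : ∀ t, N.D (ψ t) = ψ (DK t)) :
    ∃ χ : K →ₗ[k] N'.M, (∀ n, ∀ t ∈ gmK n, χ t ∈ N'.gm (n + (c - 1))) ∧
      ∀ t, N'.D (χ t) + χ (DK t) = g.f (ψ t) := by
  classical
  -- the contraction
  obtain ⟨γ, hγ⟩ := lin_lift DK (LinearMap.range DK).subtype (fun u => u.2)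
  obtain ⟨δ, hδ⟩ := LinearMap.exists_extend γ
  have hδ' : ∀ t, DK (δ (DK t)) = DK t := by
    intro t
    have h1 := congrArg (fun f => f (⟨DK t, ⟨t, rfl⟩⟩ : LinearMap.range DK)) hδ
    have h2 := hγ ⟨DK t, ⟨t, rfl⟩⟩
    simp only [LinearMap.comp_apply, Submodule.subtype_apply] at h1 h2
    rw [h1, h2]
  -- lifting on cycles
  have hcyc : ∀ u : LinearMap.ker DK, ∃ v, N'.D v = (g.f ∘ₗ ψ ∘ₗ (LinearMap.ker DK).subtype) u := by
    rintro ⟨u, hu⟩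
    simp only [LinearMap.comp_apply, Submodule.subtype_apply]
    rw [LinearMap.mem_ker] at hu
    have key : ∀ n, DK (prj gmK n u) = 0 := by
      intro n
      rw [← prj_comm gmK gmK DK 1 Dd n (n + 1) rfl, hu, map_zero]
    -- u is the sum of its components
    have hsum : u = ∑ n ∈ (DirectSum.decompose gmK u).support, prj gmK n u := by
      refine sub_eq_zero.1 (eq_of_prj gmK fun n => ?_)
      rw [map_sub, map_sum]
      by_cases hn : n ∈ (DirectSum.decompose gmK u).support
      · rw [Finset.sum_eq_single n, prj_same gmK (prj_mem gmK n u), sub_self]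
        · intro b _ hb; exact prj_ne gmK (prj_mem gmK b u) hb
        · intro h; exact absurd hn h
      · have hz : prj gmK n u = 0 := by
          have h0 : DirectSum.decompose gmK u n = 0 := by
            simpa using hn
          have hk := hom_ext gmK (f := (gmK n).subtype ∘ₗ DirectSum.component k ℤ (fun i => gmK i) n ∘ₗ
            (DirectSum.decomposeLinearEquiv gmK).toLinearMap) (g := prj gmK n) (by
              intro j m hm
              by_cases hj : j = n
              · subst hj
                rw [prj_same gmK hm]
                exact DirectSum.decompose_of_mem_same gmK hm
              · rw [prj_ne gmK hm hj]
                exact DirectSum.decompose_of_mem_ne gmK hm hj)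
          have h1 := congrArg (fun f => f u) hk
          rw [← h1]
          change ((DirectSum.decompose gmK u n : gmK n) : K) = 0
          rw [h0]; rfl
        rw [hz, Finset.sum_eq_zero, sub_self]
        intro b hb
        exact prj_ne gmK (prj_mem gmK b u) (by rintro rfl; exact hn hb)
    have hch : ∀ n, ∃ v, N'.D v = g.f (ψ (prj gmK n u)) := by
      intro n
      refine hgh _ _ (hψd n _ (prj_mem gmK n u)) ?_
      rw [hψ, key, map_zero]
    choose v hv using hch
    refine ⟨∑ n ∈ (DirectSum.decompose gmK u).support, v n, ?_⟩
    rw [map_sum]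
    conv_rhs => rw [hsum]
    rw [map_sum, map_sum]
    exact Finset.sum_congr rfl fun n _ => hv n
  obtain ⟨χ₁, hχ₁⟩ := lin_lift N'.D (g.f ∘ₗ ψ ∘ₗ (LinearMap.ker DK).subtype) hcyc
  obtain ⟨χ₀, hχ₀⟩ := LinearMap.exists_extend χ₁
  have hχ₀' : ∀ t, DK t = 0 → N'.D (χ₀ t) = g.f (ψ t) := by
    intro t ht
    have h1 := congrArg (fun f => f (⟨t, ht⟩ : LinearMap.ker DK)) hχ₀
    have h2 := hχ₁ ⟨t, ht⟩
    simp only [LinearMap.comp_apply, Submodule.subtype_apply] at h1 h2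
    rw [h1, h2]
  let e : K →ₗ[k] K := LinearMap.id - DK ∘ₗ δ - δ ∘ₗ DK
  have he : ∀ t, e t = t - DK (δ t) - δ (DK t) := fun t => rfl
  let χ : K →ₗ[k] N'.M := g.f ∘ₗ ψ ∘ₗ δ + χ₀ ∘ₗ e
  have hχ : ∀ t, χ t = g.f (ψ (δ t)) + χ₀ (e t) := fun t => rfl
  have hχe : ∀ t, N'.D (χ t) + χ (DK t) = g.f (ψ t) := by
    intro t
    have h1 : DK (e t) = 0 := by rw [he, map_sub, map_sub, Dsq, hδ']; simp
    have h2 : e (DK t) = 0 := by rw [he, Dsq, hδ']; simp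
    rw [hχ, hχ, h2, map_zero, add_zero, map_add, hχ₀' _ h1, ← g.comm, hψ, he]
    simp only [map_sub]; abel
  refine ⟨hg gmK N'.gm (c - 1) χ, fun n t ht => ?_, fun t => ?_⟩
  · rw [hg_apply gmK _ _ _ ht]; exact prj_mem _ _ _
  · have := hom_ext gmK (f := N'.D ∘ₗ hg gmK N'.gm (c - 1) χ + hg gmK N'.gm (c - 1) χ ∘ₗ DK)
      (g := g.f ∘ₗ ψ) (by
        intro n t ht
        simp only [LinearMap.add_apply, LinearMap.comp_apply]
        rw [hg_apply gmK _ _ _ ht, hg_apply gmK _ _ _ (Dd n t ht),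
          ← prj_comm N'.gm N'.gm N'.D 1 N'.D_deg _ (n + c) (by ring),
          show n + 1 + (c - 1) = n + c by ring, ← map_add, hχe]
        exact prj_same _ (g.deg _ _ (hψd n t ht)))
    exact congrArg (fun f => f t) this

/-! ### Semi-free modules over complexes of vector spaces and the ghost lemma -/
section ghost
variable {K : Type} [AddCommGroup K] [Module k K] (gmK : ℤ → Submodule k K)

/-- the filtration -/
def Wf (W : DGMod A) {s : ℕ} (st : Fin s → K →ₗ[k] W.M) (m : ℕ) : Submodule k W.M :=
  Submodule.span k {w | ∃ l : Fin s, l.1 < m ∧ ∃ n t, t ∈ gmK n ∧ ∃ q y, y ∈ A.gr q ∧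
    w = W.act y (st l t)}

structure SemiFree (DK : K →ₗ[k] K) (W : DGMod A) {s : ℕ} (ρ : Fin s → ℤ)
    (st : Fin s → K →ₗ[k] W.M) : Prop where
  Dd : ∀ n, ∀ t ∈ gmK n, DK t ∈ gmK (n + 1)
  Dsq : ∀ t, DK (DK t) = 0
  deg : ∀ l n, ∀ t ∈ gmK n, st l t ∈ W.gm (n - ρ l)
  low : ∀ l t, W.D (st l t) - st l (DK t) ∈ Wf gmK W st l.1
  top : ∀ w, w ∈ Wf gmK W st s
  ext : ∀ (l : Fin s) (N : DGMod A) (χ : K →ₗ[k] N.M) (c : ℤ),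
    (∀ n, ∀ t ∈ gmK n, χ t ∈ N.gm (n - ρ l + c)) →
    ∃ Θ : W.M →ₗ[k] N.M, (∀ n, ∀ w ∈ W.gm n, Θ w ∈ N.gm (n + c)) ∧
      (∀ x w, Θ (W.act x w) = N.act x (Θ w)) ∧ (∀ t, Θ (st l t) = χ t) ∧
      ∀ l', l' ≠ l → ∀ t, Θ (st l' t) = 0

/-- a partial null-homotopy -/
def PartNull (W : DGMod A) {s : ℕ} (st : Fin s → K →ₗ[k] W.M) {N : DGMod A} (Ψ : DGHom W N)
    (m : ℕ) : Prop :=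
  ∃ Λ : W.M →ₗ[k] N.M, (∀ j, ∀ w ∈ W.gm j, Λ w ∈ N.gm (j - 1)) ∧
    (∀ x w, Λ (W.act x w) = N.act x (Λ w)) ∧
    ∀ w ∈ Wf gmK W st m, N.D (Λ w) + Λ (W.D w) = Ψ.f w

theorem ghost_step [DirectSum.Decomposition gmK] {DK : K →ₗ[k] K} {W : DGMod A} {s : ℕ}
    {ρ : Fin s → ℤ} {st : Fin s → K →ₗ[k] W.M} (SF : SemiFree gmK DK W ρ st)
    {N N' : DGMod A} (g : DGHom N N')
    (hgh : ∀ n, ∀ z ∈ N.gm n, N.D z = 0 → ∃ y, N'.D y = g.f z)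
    (Ψ : DGHom W N) {m : ℕ} (hm : m < s) (H : PartNull gmK W st Ψ m) :
    PartNull gmK W st (g.comp Ψ) (m + 1) := by
  obtain ⟨Λ, Λd, Λa, Λh⟩ := H
  let l : Fin s := ⟨m, hm⟩
  let L : K →ₗ[k] W.M := W.D ∘ₗ st l - st l ∘ₗ DK
  have hL : ∀ t, L t = W.D (st l t) - st l (DK t) := fun t => rfl
  have hLW : ∀ t, L t ∈ Wf gmK W st m := fun t => SF.low l t
  have hDL : ∀ t, W.D (L t) = - L (DK t) := by
    intro t; rw [hL, hL, map_sub, W.D_sq, SF.Dsq, map_zero]; abel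
  have hLd : ∀ n, ∀ t ∈ gmK n, L t ∈ W.gm (n - ρ l + 1) := by
    intro n t ht
    refine (W.gm _).sub_mem (W.D_deg _ _ (SF.deg l n t ht)) ?_
    have := SF.deg l _ _ (SF.Dd n t ht)
    rwa [show n + 1 - ρ l = n - ρ l + 1 by ring] at this
  let ψ : K →ₗ[k] N.M := Ψ.f ∘ₗ st l - Λ ∘ₗ L
  have hψe : ∀ t, ψ t = Ψ.f (st l t) - Λ (L t) := fun t => rfl
  obtain ⟨χ, χd, χh⟩ := null_k gmK DK SF.Dd SF.Dsq g hgh (-ρ l) ψ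
    (by
      intro n t ht
      refine (N.gm _).sub_mem ?_ ?_
      · exact Ψ.deg _ _ (SF.deg l n t ht)
      · have := Λd _ _ (hLd n t ht)
        rwa [show n - ρ l + 1 - 1 = n + -ρ l by ring] at this)
    (by
      intro t
      have h := Λh _ (hLW t)
      rw [hDL, map_neg] at h
      have h' : N.D (Λ (L t)) = Ψ.f (L t) + Λ (L (DK t)) := by
        rw [← h]; abel
      rw [hψe, hψe, map_sub, h', ← Ψ.comm, hL t, map_sub]; abel)
  obtain ⟨Θ, Θd, Θa, Θl, Θ0⟩ := SF.ext l N' (χ - g.f ∘ₗ Λ ∘ₗ st l) (-1) (by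
    intro n t ht
    refine (N'.gm _).sub_mem ?_ ?_
    · have := χd n t ht
      rwa [show n + (-ρ l - 1) = n - ρ l + -1 by ring] at this
    · exact g.deg _ _ (Λd _ _ (SF.deg l n t ht)))
  have hΘ0 : ∀ w ∈ Wf gmK W st m, Θ w = 0 := by
    intro w hw
    have : Wf gmK W st m ≤ LinearMap.ker Θ := by
      refine Submodule.span_le.2 ?_
      rintro w ⟨l', hl', n, t, ht, q, y, hy, rfl⟩
      have : l' ≠ l := by
        rintro rfl; exact lt_irrefl _ hl'
      change Θ _ = 0
      rw [Θa, Θ0 l' this, map_zero]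
    exact this hw
  let Λ' : W.M →ₗ[k] N'.M := g.f ∘ₗ Λ + Θ
  have hΛ' : ∀ w, Λ' w = g.f (Λ w) + Θ w := fun w => rfl
  have Λ'd : ∀ j, ∀ w ∈ W.gm j, Λ' w ∈ N'.gm (j - 1) := fun j w hw =>
    (N'.gm _).add_mem (g.deg _ _ (Λd _ _ hw)) (Θd _ _ hw)
  have Λ'a : ∀ x w, Λ' (W.act x w) = N'.act x (Λ' w) := by
    intro x w; rw [hΛ', hΛ', Λa, Θa, g.actc, map_add]
  have Λ'l : ∀ t, Λ' (st l t) = χ t := by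
    intro t; rw [hΛ', Θl]; simp
  have Λ'0 : ∀ w ∈ Wf gmK W st m, Λ' w = g.f (Λ w) := by
    intro w hw; rw [hΛ', hΘ0 w hw, add_zero]
  -- closure of the identity under the action
  have hclos : ∀ j, ∀ w ∈ W.gm j, N'.D (Λ' w) + Λ' (W.D w) = g.f (Ψ.f w) → ∀ y : A.R,
      N'.D (Λ' (W.act y w)) + Λ' (W.D (W.act y w)) = g.f (Ψ.f (W.act y w)) := by
    intro j w hw h y
    rw [Λ'a, N'.leib (Λ'd j w hw), W.leib hw, map_add, map_zsmul, Λ'a, Λ'a, Ψ.actc, g.actc, ← h,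
      map_add, sgnz_sub_one]
    simp only [neg_smul]; abel
  have hst : ∀ t, N'.D (Λ' (st l t)) + Λ' (W.D (st l t)) = g.f (Ψ.f (st l t)) := by
    intro t
    have h1 : W.D (st l t) = st l (DK t) + L t := by rw [hL]; abel
    rw [h1, map_add, Λ'l, Λ'l, Λ'0 _ (hLW t), ← add_assoc, χh, hψe, map_sub]; abel
  -- the identity on the lower generators
  have hlow : ∀ l' : Fin s, l'.1 < m → ∀ n, ∀ t ∈ gmK n,
      N'.D (Λ' (st l' t)) + Λ' (W.D (st l' t)) = g.f (Ψ.f (st l' t)) := by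
    intro l' hl' n t ht
    have hin : ∀ m', l'.1 < m' → ∀ n, ∀ t ∈ gmK n, st l' t ∈ Wf gmK W st m' := by
      intro m' hm' n t ht
      refine Submodule.subset_span ⟨l', hm', n, t, ht, 0, 1, A.one_mem, (W.act_one _).symm⟩
    have hmono : Wf gmK W st l'.1 ≤ Wf gmK W st m := by
      refine Submodule.span_mono ?_
      rintro w ⟨l'', h, r⟩
      exact ⟨l'', h.trans hl', r⟩
    have hD : W.D (st l' t) ∈ Wf gmK W st m := by
      have h1 := hmono (SF.low l' t)
      have h2 := hin m hl' _ _ (SF.Dd n t ht)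
      have := Submodule.add_mem _ h1 h2
      simpa using this
    have := Λh _ (hin m hl' n t ht)
    rw [Λ'0 _ (hin m hl' n t ht), Λ'0 _ hD, ← g.comm, ← map_add, this]
  refine ⟨Λ', Λ'd, Λ'a, fun w hw => ?_⟩
  have : Wf gmK W st (m + 1) ≤
      LinearMap.eqLocus (N'.D ∘ₗ Λ' + Λ' ∘ₗ W.D) (g.f ∘ₗ Ψ.f) := by
    refine Submodule.span_le.2 ?_
    rintro w ⟨l', hl', n, t, ht, q, y, hy, rfl⟩
    refine hclos _ _ (SF.deg l' n t ht) ?_ y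
    rcases Nat.lt_succ_iff_lt_or_eq.1 hl' with h | h
    · exact hlow l' h n t ht
    · have : l' = l := Fin.ext h
      subst this; exact hst t
  exact this hw

theorem partNull_zero {W : DGMod A} {s : ℕ} (st : Fin s → K →ₗ[k] W.M) {N : DGMod A}
    (Ψ : DGHom W N) : PartNull gmK W st Ψ 0 := by
  refine ⟨0, fun j w _ => (N.gm _).zero_mem, by simp, fun w hw => ?_⟩
  have h0 : Wf gmK W st 0 = ⊥ := by
    refine Submodule.span_eq_bot.2 ?_
    rintro w ⟨l, hl, _⟩; omega
  rw [h0, Submodule.mem_bot] at hw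
  subst hw; simp

theorem null_of_partNull {DK : K →ₗ[k] K} {W : DGMod A} {s : ℕ}
    {ρ : Fin s → ℤ} {st : Fin s → K →ₗ[k] W.M} (SF : SemiFree gmK DK W ρ st) {N : DGMod A}
    {Ψ : DGHom W N} (H : PartNull gmK W st Ψ s) : Homotopic Ψ (DGHom.zero W N) := by
  obtain ⟨Λ, h1, h2, h3⟩ := H
  refine ⟨Λ, h1, h2, fun w => ?_⟩
  rw [h3 w (SF.top w)]
  simp [DGHom.zero]

/-- maps from a semi-free module to an acyclic one are null-homotopic -/
theorem null_of_acyclic [DirectSum.Decomposition gmK] {DK : K →ₗ[k] K} {W : DGMod A} {s : ℕ}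
    {ρ : Fin s → ℤ} {st : Fin s → K →ₗ[k] W.M} (SF : SemiFree gmK DK W ρ st) {N : DGMod A}
    (hN : ∀ n, ∀ z ∈ N.gm n, N.D z = 0 → ∃ y, N.D y = z)
    (Ψ : DGHom W N) : Homotopic Ψ (DGHom.zero W N) := by
  have : ∀ m, m ≤ s → PartNull gmK W st Ψ m := by
    intro m
    induction m with
    | zero => intro _; exact partNull_zero gmK st Ψ
    | succ m ih =>
      intro hm
      exact ghost_step gmK SF (DGHom.id N) hN Ψ (by omega) (ih (by omega))
  exact null_of_partNull gmK SF (this s le_rfl)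

end ghost

/-! ### Twisted complexes with coefficients in a bimodule -/
theorem DGBimod.leibL (X : DGBimod A) {i : ℤ} {x : A.R} (hx : x ∈ A.gr i) (m : X.M) :
    X.D (X.actL x m) = X.actL (A.d x) m + sgnz i • X.actL x (X.D m) := by
  have := hom_ext X.gm (f := X.D ∘ₗ X.actL x)
    (g := X.actL (A.d x) + sgnz i • (X.actL x ∘ₗ X.D)) (by
      intro j m hm
      simpa using X.leibnizL i j x m hx hm)
  simpa using congrArg (fun f => f m) this

theorem DGBimod.leibR (X : DGBimod A) {j : ℤ} {m : X.M} (hm : m ∈ X.gm j) (x : A.R) :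
    X.D (X.actR x m) = X.actR x (X.D m) + sgnz j • X.actR (A.d x) m := by
  have := hom_ext A.gr (f := X.D ∘ₗ X.actR.flip m)
    (g := X.actR.flip (X.D m) + sgnz j • (X.actR.flip m ∘ₗ A.d)) (by
      intro i x hx
      simpa using X.leibnizR i j x m hx hm)
  simpa using congrArg (fun f => f x) this

structure TwData (A : DGAlgebra k) where
  s : ℕ
  r : Fin s → ℤ
  τ : Fin s → Fin s → A.R
  deg : ∀ i j, τ i j ∈ A.gr (1 + r i - r j)
  tri : ∀ i j, ¬ i < j → τ i j = 0
  mc : ∀ l j, sgnz (r l) • A.d (τ l j) + ∑ i, τ l i * τ i j = 0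

/-- grading -/
def piGr {s : ℕ} (r : Fin s → ℤ) {M : Type} [AddCommGroup M] [Module k M]
    (gm : ℤ → Submodule k M) (n : ℤ) : Submodule k (Fin s → M) :=
  Submodule.pi Set.univ (fun i => gm (n + r i))

theorem mem_piGr {s : ℕ} {r : Fin s → ℤ} {M : Type} [AddCommGroup M] [Module k M]
    {gm : ℤ → Submodule k M} {n : ℤ} {v : Fin s → M} :
    v ∈ piGr r gm n ↔ ∀ i, v i ∈ gm (n + r i) := by
  simp [piGr, Submodule.mem_pi]

@[reducible] def piDec {s : ℕ} (r : Fin s → ℤ) {M : Type} [AddCommGroup M] [Module k M]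
    (gm : ℤ → Submodule k M) [DirectSum.Decomposition gm] :
    DirectSum.Decomposition (piGr r gm) :=
  mkDec _ (fun n => LinearMap.pi (fun i => prj gm (n + r i) ∘ₗ LinearMap.proj i))
    (by
      intro n v hv
      funext i
      exact prj_same gm (mem_piGr.1 hv i))
    (by
      intro n n' h v hv
      funext i
      exact prj_ne gm (mem_piGr.1 hv i) (by omega))
    (by
      classical
      intro v
      have : v = ∑ i, Pi.single i (v i) := (Finset.univ_sum_single v).symm
      rw [this]
      refine Submodule.sum_mem _ fun i _ => ?_
      refine hom_ind gm (p := Submodule.comap (LinearMap.single k (fun _ => M) i)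
          (⨆ n, piGr r gm n)) (fun n m hm => ?_) (v i)
      refine Submodule.mem_iSup_of_mem (n - r i) (mem_piGr.2 fun j => ?_)
      by_cases h : j = i
      · subst h; simpa using hm
      · simp [h])

def twAct (X : TwData A) (M : DGBimod A) : A.R →ₗ[k] (Fin X.s → M.M) →ₗ[k] (Fin X.s → M.M) :=
  LinearMap.mk₂ k (fun a v i => M.actR a (v i))
    (by intros; funext; simp) (by intros; funext; simp) (by intros; funext; simp)
    (by intros; funext; simp)

theorem twAct_apply (X : TwData A) (M : DGBimod A) (a : A.R) (v : Fin X.s → M.M) (i : Fin X.s) :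
    twAct X M a v i = M.actR a (v i) := rfl

def twD (X : TwData A) (M : DGBimod A) : (Fin X.s → M.M) →ₗ[k] (Fin X.s → M.M) :=
  LinearMap.pi (fun i => sgnz (X.r i) • (M.D ∘ₗ LinearMap.proj i) +
    ∑ j, M.actL (X.τ i j) ∘ₗ LinearMap.proj j)

theorem twD_apply (X : TwData A) (M : DGBimod A) (v : Fin X.s → M.M) (i : Fin X.s) :
    twD X M v i = sgnz (X.r i) • M.D (v i) + ∑ j, M.actL (X.τ i j) (v j) := by
  simp [twD]

@[reducible] def Tw (X : TwData A) (M : DGBimod A) : DGMod A where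
  M := Fin X.s → M.M
  gm := piGr X.r M.gm
  dec := piDec X.r M.gm
  act := twAct X M
  act_one v := by funext i; simp [twAct_apply, M.actR_one]
  act_mul x y v := by funext i; simp [twAct_apply, M.actR_mul]
  act_deg i j x v hx hv := mem_piGr.2 fun l => by
    have := M.actR_deg i _ x _ hx (mem_piGr.1 hv l)
    rw [twAct_apply, show j + i + X.r l = j + X.r l + i by ring]; exact this
  D := twD X M
  D_deg n v hv := mem_piGr.2 fun l => by
    rw [twD_apply]
    refine Submodule.add_mem _ (zsmul_mem' _ _ ?_) (Submodule.sum_mem _ fun j _ => ?_)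
    · have := M.D_deg _ _ (mem_piGr.1 hv l)
      rwa [show n + 1 + X.r l = n + X.r l + 1 by ring]
    · have := M.actL_deg _ _ _ _ (X.deg l j) (mem_piGr.1 hv j)
      rwa [show n + 1 + X.r l = 1 + X.r l - X.r j + (n + X.r j) by ring]
  D_sq v := by
    funext l
    have key : ∀ j, sgnz (X.r l) • M.D (M.actL (X.τ l j) (v j)) =
        sgnz (X.r l) • M.actL (A.d (X.τ l j)) (v j) - sgnz (X.r j) • M.actL (X.τ l j) (M.D (v j)) := by
      intro j
      rw [M.leibL (X.deg l j), smul_add, smul_smul, sgnz_sub, sgnz_add, sgnz_one,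
        show sgnz (X.r l) * (-1 * sgnz (X.r l) * sgnz (X.r j)) =
          -((sgnz (X.r l) * sgnz (X.r l)) * sgnz (X.r j)) by ring, sgnz_mul_self, one_mul, neg_smul]
      abel
    have mc : ∀ j, M.actL (∑ i, X.τ l i * X.τ i j) (v j) =
        - (sgnz (X.r l) • M.actL (A.d (X.τ l j)) (v j)) := by
      intro j
      rw [eq_neg_of_add_eq_zero_right (X.mc l j), map_neg, map_zsmul]; simp
    have h2 : ∑ i, M.actL (X.τ l i) (∑ j, M.actL (X.τ i j) (v j)) =
        ∑ j, - (sgnz (X.r l) • M.actL (A.d (X.τ l j)) (v j)) := by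
      simp only [map_sum]
      rw [Finset.sum_comm]
      refine Finset.sum_congr rfl fun j _ => ?_
      rw [← mc]
      simp [LinearMap.sum_apply, M.actL_mul]
    rw [twD_apply, twD_apply]
    simp only [twD_apply, map_add, Finset.sum_add_distrib]
    rw [h2, map_zsmul, M.D_sq, map_sum, smul_zero, zero_add, Finset.smul_sum]
    simp only [key, map_zsmul, Finset.sum_sub_distrib, Finset.sum_neg_distrib, Pi.zero_apply]
    abel
  leibniz i j x v hx hv := by
    funext l
    rw [Pi.add_apply, Pi.smul_apply, twD_apply]
    simp only [twAct_apply]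
    rw [twD_apply, M.leibR (mem_piGr.1 hv l), map_add, map_sum, smul_add, smul_smul, sgnz_add,
      show sgnz (X.r l) * (sgnz j * sgnz (X.r l)) = sgnz j * (sgnz (X.r l) * sgnz (X.r l)) by ring,
      sgnz_mul_self, mul_one, map_zsmul]
    simp only [M.actLR]
    abel

theorem Tw_D (X : TwData A) (M : DGBimod A) (v : Fin X.s → M.M) (i : Fin X.s) :
    (Tw X M).D v i = sgnz (X.r i) • M.D (v i) + ∑ j, M.actL (X.τ i j) (v j) := twD_apply X M v i

theorem Tw_act (X : TwData A) (M : DGBimod A) (a : A.R) (v : Fin X.s → M.M) (i : Fin X.s) :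
    (Tw X M).act a v i = M.actR a (v i) := rfl

def TwMap (X : TwData A) {M N : DGBimod A} (f : BimodHom M N) : DGHom (Tw X M) (Tw X N) :=
  ⟨LinearMap.pi (fun i => f.f ∘ₗ LinearMap.proj i),
    fun j v hv => mem_piGr.2 fun i => f.deg _ _ (mem_piGr.1 hv i),
    fun x v => by funext i; exact f.actRc _ _,
    fun v => by
      funext i
      change f.f ((Tw X M).D v i) = (Tw X N).D (fun i => f.f (v i)) i
      rw [Tw_D, Tw_D, map_add, map_zsmul, f.comm, map_sum]
      simp only [f.actLc]⟩

theorem TwMap_apply (X : TwData A) {M N : DGBimod A} (f : BimodHom M N) (v : Fin X.s → M.M) (i) :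
    (TwMap X f).f v i = f.f (v i) := rfl

theorem TwMap_homotopic (X : TwData A) {M N : DGBimod A} {f g : BimodHom M N}
    (h : BimodHomotopic f g) : Homotopic (TwMap X f) (TwMap X g) := by
  obtain ⟨h, h1, h2, h3, h4⟩ := h
  refine ⟨LinearMap.pi (fun i => sgnz (X.r i) • (h ∘ₗ LinearMap.proj i)),
    fun j v hv => mem_piGr.2 fun i => ?_, fun x v => ?_, fun v => ?_⟩
  · have := h1 _ _ (mem_piGr.1 hv i)
    rw [show j - 1 + X.r i = j + X.r i - 1 by ring]
    exact zsmul_mem' _ _ this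
  · funext i
    change sgnz (X.r i) • h (M.actR x (v i)) = N.actR x (sgnz (X.r i) • h (v i))
    rw [h3, map_zsmul]
  · funext i
    change f.f (v i) - g.f (v i) = (Tw X N).D (fun i => sgnz (X.r i) • h (v i)) i +
      sgnz (X.r i) • h ((Tw X M).D v i)
    rw [Tw_D, Tw_D, h4, map_add, map_zsmul, map_zsmul, smul_add, sgnz_smul_smul, sgnz_smul_smul,
      map_sum, Finset.smul_sum]
    have : ∀ j, sgnz (X.r i) • h (M.actL (X.τ i j) (v j)) =
        - N.actL (X.τ i j) (sgnz (X.r j) • h (v j)) := by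
      intro j
      rw [h2 _ _ (X.deg i j), smul_smul, sgnz_sub, sgnz_add, sgnz_one, map_zsmul,
        show sgnz (X.r i) * (-1 * sgnz (X.r i) * sgnz (X.r j)) =
          -((sgnz (X.r i) * sgnz (X.r i)) * sgnz (X.r j)) by ring, sgnz_mul_self, one_mul, neg_smul]
    simp only [this, Finset.sum_neg_distrib]
    abel

/-- reducible copy of the diagonal bimodule -/
@[reducible] def dg (A : DGAlgebra k) : DGBimod A where
  M := A.R
  gm := A.gr
  actL := LinearMap.mul k A.R
  actR := (LinearMap.mul k A.R).flip
  actL_one := fun m => one_mul m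
  actR_one := fun m => mul_one m
  actL_mul := fun x y m => mul_assoc x y m
  actR_mul := fun x y m => (mul_assoc m x y).symm
  actLR := fun x y m => (mul_assoc x m y).symm
  actL_deg := fun i j x m hx hm => A.mul_mem hx hm
  actR_deg := fun i j x m hx hm => A.mul_mem hm hx
  D := A.d
  D_deg := A.d_deg
  D_sq := A.d_sq
  leibnizL := fun i j x m hx _ => A.leibniz i x hx m
  leibnizR := fun i j x m _ hm => A.leibniz j m hm x

theorem dg_eq (A : DGAlgebra k) : diagBimod A = dg A := rfl

/-! ### Twisted modules in coordinates -/
theorem graded_inj {M M' : Type} [AddCommGroup M] [Module k M] [AddCommGroup M'] [Module k M']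
    (gm : ℤ → Submodule k M) [DirectSum.Decomposition gm]
    (gm' : ℤ → Submodule k M') [DirectSum.Decomposition gm'] (f : M →ₗ[k] M')
    (hf : ∀ n, ∀ m ∈ gm n, f m ∈ gm' n) (inj : Function.Injective f) {n : ℤ} {m : M}
    (h : f m ∈ gm' n) : m ∈ gm n := by
  have h1 := prj_comm gm gm' f 0 (by simpa using hf) n n (by simp) m
  rw [prj_same gm' h] at h1
  rw [inj h1]; exact prj_mem gm n m

theorem twisted_coord {T : DGMod A} (hT : IsTwisted T) :
    ∃ X : TwData A, IsHoSummand T (Tw X (dg A)) := by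
  classical
  obtain ⟨s, r, e, he, hD, hb⟩ := hT
  let β : (Fin s → A.R) →ₗ[k] T.M := ∑ j, T.act.flip (e j) ∘ₗ LinearMap.proj j
  have hβ : ∀ v, β v = ∑ j, T.act (v j) (e j) := by
    intro v; simp [β, LinearMap.sum_apply]
  have hbij : Function.Bijective β := by
    have : (β : (Fin s → A.R) → T.M) = fun v => ∑ j, T.act (v j) (e j) := funext hβ
    rw [this]; exact hb
  let _ := piDec r A.gr
  have hdeg : ∀ n, ∀ v ∈ piGr r A.gr n, β v ∈ T.gm n := by
    intro n v hv
    rw [hβ]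
    refine Submodule.sum_mem _ fun j _ => ?_
    have := T.act_deg _ _ _ _ (mem_piGr.1 hv j) (he j)
    rwa [show -r j + (n + r j) = n by ring] at this
  have hact : ∀ x v, T.act x (β v) = β (fun i => v i * x) := by
    intro x v; simp [hβ, T.act_mul]
  have hτ : ∀ j, ∃ v : Fin s → A.R, (∀ i, ¬ i < j → v i = 0) ∧ β v = T.D (e j) := by
    intro j
    let q : Submodule k (Fin s → A.R) := ⨅ i, ⨅ (_ : ¬ i < j), LinearMap.ker (LinearMap.proj i)
    have hq : ∀ v, v ∈ q ↔ ∀ i, ¬ i < j → v i = 0 := by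
      intro v; simp [q, Submodule.mem_iInf]
    have : rSpan T (e '' {i | i < j}) ≤ q.map β := by
      refine sInf_le ⟨?_, ?_⟩
      · rintro _ ⟨i, hi, rfl⟩
        refine ⟨Pi.single i 1, (hq _).2 fun i' hi' => ?_, ?_⟩
        · rw [Pi.single_eq_of_ne]; rintro rfl; exact hi' hi
        · rw [hβ, Finset.sum_eq_single i]
          · simp [T.act_one]
          · intro b _ hb; simp [hb]
          · simp
      · rintro x _ ⟨v, hv, rfl⟩
        refine ⟨fun i => v i * x, (hq _).2 fun i hi => ?_, (hact x v).symm⟩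
        rw [(hq v).1 hv i hi, zero_mul]
    obtain ⟨v, hv, h⟩ := this (hD j)
    exact ⟨v, (hq v).1 hv, h⟩
  choose t ht0 ht using hτ
  have hDβ : ∀ v, T.D (β v) = β (fun l => sgnz (r l) • A.d (v l) + ∑ i, t i l * v i) := by
    intro v
    have h1 : ∀ i, T.D (T.act (v i) (e i)) = β (fun l => t i l * v i) +
        sgnz (r i) • T.act (A.d (v i)) (e i) := by
      intro i
      rw [T.leib (he i), ← ht, hact, sgnz_neg]
    have h2 : (fun l => sgnz (r l) • A.d (v l) + ∑ i, t i l * v i) =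
        (fun l => sgnz (r l) • A.d (v l)) + ∑ i, (fun l => t i l * v i) := by
      funext l; simp
    rw [h2, map_add, hβ v, map_sum, map_sum, hβ (fun l => _)]
    simp only [h1, Finset.sum_add_distrib, map_zsmul, LinearMap.smul_apply]
    abel
  let X : TwData A :=
    { s := s
      r := r
      τ := fun i j => t j i
      deg := fun i j => by
        have h1 : t j ∈ piGr r A.gr (-r j + 1) := by
          refine graded_inj (piGr r A.gr) T.gm β hdeg hbij.1 ?_
          rw [ht]; exact T.D_deg _ _ (he j)
        have := mem_piGr.1 h1 i
        rwa [show -r j + 1 + r i = 1 + r i - r j by ring] at this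
      tri := fun i j h => ht0 j i h
      mc := fun l j => by
        have h1 := hDβ (t j)
        rw [ht, T.D_sq] at h1
        have h2 := hbij.1 (h1.symm.trans (map_zero β).symm)
        exact congrFun h2 l }
  let ε := LinearEquiv.ofBijective β hbij
  have hεs : ∀ m, β (ε.symm m) = m := fun m => ε.apply_symm_apply m
  let F : DGHom (Tw X (dg A)) T := ⟨β, hdeg, fun x v => (hact x v).symm, fun v => by
    rw [hDβ]
    congr 1
    funext l
    exact Tw_D X (dg A) v l⟩
  let G : DGHom T (Tw X (dg A)) := ⟨ε.symm.toLinearMap,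
    fun n m hm => graded_inj (piGr r A.gr) T.gm β hdeg hbij.1 (by
      change β (ε.symm m) ∈ _
      rw [hεs]; exact hm),
    fun x m => hbij.1 (by
      change β (ε.symm _) = β _
      rw [hεs]
      have := F.actc x (ε.symm m)
      change β ((Tw X (dg A)).act x (ε.symm m)) = T.act x (β (ε.symm m)) at this
      rw [hεs] at this; exact this.symm),
    fun m => hbij.1 (by
      change β (ε.symm _) = β _
      rw [hεs]
      have := F.comm (ε.symm m)
      change β _ = T.D (β (ε.symm m)) at this
      rw [hεs] at this; exact this.symm)⟩
  refine ⟨X, G, F, ?_⟩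
  have : F.comp G = DGHom.id T := by
    have : (F.comp G).f = LinearMap.id := LinearMap.ext hεs
    unfold DGHom.id
    cases h : F.comp G with
    | mk f h1 h2 h3 => rw [h] at this; subst this; rfl
  rw [this]; exact Homotopic.refl' _

/-! ### Zero twist -/
@[reducible] def zTw (A : DGAlgebra k) (s : ℕ) (r : Fin s → ℤ) : TwData A where
  s := s
  r := r
  τ := 0
  deg _ _ := Submodule.zero_mem _
  tri _ _ _ := rfl
  mc l j := by simp

/-- the free module with zero twist -/
@[reducible] def Fr (A : DGAlgebra k) (s : ℕ) (r : Fin s → ℤ) : DGMod A :=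
  Tw (zTw A s r) (dg A)

theorem Fr_D (s : ℕ) (r : Fin s → ℤ) (v : Fin s → A.R) (i : Fin s) :
    (Fr A s r).D v i = sgnz (r i) • A.d (v i) := by
  have := Tw_D (zTw A s r) (dg A) v i
  rw [this]
  have : ∑ j, (dg A).actL ((zTw A s r).τ i j) (v j) = 0 := by
    refine Finset.sum_eq_zero fun j _ => ?_
    change (0 : A.R) * (v j) = 0
    exact zero_mul _
  rw [this, add_zero]

theorem Fr_act (s : ℕ) (r : Fin s → ℤ) (a : A.R) (v : Fin s → A.R) (i : Fin s) :
    (Fr A s r).act a v i = v i * a := rfl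

@[reducible] def Gn (A : DGAlgebra k) : DGMod A := Fr A 1 (fun _ => 0)

theorem d_one : A.d 1 = 0 := by
  have := A.leibniz 0 1 A.one_mem 1
  rw [sgnz_zero] at this
  simpa using this

theorem Gn_perfect : IsPerfect (Gn A) := by
  refine ⟨Gn A, Gn A, ?_, IsHoSummand.refl' _, DGHom.id _, ?_⟩
  · refine ⟨1, fun _ => 0, fun _ _ => (1 : A.R), fun j => mem_piGr.2 fun i => ?_, fun j => ?_, ?_⟩
    · exact A.one_mem
    · have : (Gn A).D (fun _ => (1 : A.R)) = 0 := by
        funext i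
        rw [Fr_D, d_one]; exact smul_zero _
      rw [this]; exact Submodule.zero_mem _
    · have : (fun v : Fin 1 → A.R => ∑ j, (Gn A).act (v j) (fun _ => (1 : A.R))) = id := by
        funext v i
        have hi : i = 0 := Subsingleton.elim _ _
        subst hi
        rw [Fin.sum_univ_one, Fr_act, one_mul]; rfl
      rw [this]; exact Function.bijective_id
  · refine ⟨fun n x hx => hx, fun n x hx => hx, fun n => ⟨fun z hz => ⟨z, hz, ?_⟩, fun w _ h => h⟩⟩
    change z - z ∈ _
    rw [sub_self]; exact Submodule.zero_mem _

theorem Fr_shift (s : ℕ) (r : Fin s → ℤ) :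
    IsShiftOf (Fr A s (fun i => r i - 1)) (Fr A s r) 1 := by
  refine ⟨LinearEquiv.refl k (Fin s → A.R), fun n m hm => mem_piGr.2 fun i => ?_, fun _ _ => rfl,
    fun m => ?_⟩
  · have := mem_piGr.1 hm i
    change m i ∈ A.gr (n + 1 + (r i - 1)) at this
    rw [show n + 1 + (r i - 1) = n + r i by ring] at this
    exact this
  · funext i
    change (Fr A s (fun i => r i - 1)).D m i = (sgnz 1 • (Fr A s r).D m) i
    rw [Pi.smul_apply, Fr_D, Fr_D, sgnz_one, sgnz_sub_one]
    simp

theorem Fr_one (r : Fin 1 → ℤ) : IsShiftOf (Gn A) (Fr A 1 r) (r 0) := by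
  refine ⟨LinearEquiv.refl k (Fin 1 → A.R), fun n m hm => mem_piGr.2 fun i => ?_, fun _ _ => rfl,
    fun m => ?_⟩
  · have := mem_piGr.1 hm i
    change m i ∈ A.gr (n + r 0 + 0) at this
    have hi : i = 0 := Subsingleton.elim _ _
    subst hi
    rw [add_zero] at this
    exact this
  · funext i
    have hi : i = 0 := Subsingleton.elim _ _
    subst hi
    change (Gn A).D m 0 = (sgnz (r 0) • (Fr A 1 r).D m) 0
    rw [Pi.smul_apply, Fr_D, Fr_D, sgnz_smul_smul, sgnz_zero, one_smul]

def frMap {s t : ℕ} {r : Fin s → ℤ} {r' : Fin t → ℤ} (φ : Fin t → Option (Fin s))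
    (h : ∀ j i, φ j = some i → r' j = r i) : DGHom (Fr A s r) (Fr A t r') where
  f := LinearMap.pi (fun j => match φ j with | none => 0 | some i => LinearMap.proj i)
  deg n v hv := mem_piGr.2 fun j => by
    rw [LinearMap.pi_apply]
    change _ ∈ A.gr (n + r' j)
    cases hj : φ j with
    | none => exact Submodule.zero_mem _
    | some i => rw [h j i hj]; exact mem_piGr.1 hv i
  actc x v := by
    funext j
    rw [Fr_act, LinearMap.pi_apply, LinearMap.pi_apply]
    cases hj : φ j with
    | none => simp
    | some i => rfl
  comm v := by
    funext j
    rw [Fr_D, LinearMap.pi_apply, LinearMap.pi_apply]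
    cases hj : φ j with
    | none => simp
    | some i => rw [h j i hj]; exact Fr_D s r v i

theorem Fr_succ (s : ℕ) (r : Fin (s + 1) → ℤ) :
    IsBiproductOf (Fr A 1 (fun _ => r 0)) (Fr A s (fun i => r i.succ)) (Fr A (s + 1) r) := by
  refine ⟨frMap (Fin.cases (some 0) (fun _ => none)) ?_, frMap (Fin.cases none (fun i => some i)) ?_,
    frMap (fun _ => some 0) ?_, frMap (fun i => some i.succ) ?_, ?_, ?_, ?_, ?_, ?_⟩
  · intro j i h
    refine Fin.cases (fun h => ?_) (fun j h => ?_) j h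
    · rfl
    · simp at h
  · intro j i h
    refine Fin.cases (fun h => ?_) (fun j h => ?_) j h
    · simp at h
    · simp at h; rw [h]
  · intro j i h; simp at h; rw [h]
  · intro j i h; simp at h; rw [h]
  · intro x; funext j
    have hi : j = 0 := Subsingleton.elim _ _
    subst hi; rfl
  · intro y; funext j; rfl
  · intro y; funext j; rfl
  · intro y; funext j; rfl
  · intro z; funext j
    refine Fin.cases ?_ (fun j => ?_) j
    · exact add_zero (z 0)
    · exact zero_add (z j.succ)

theorem Fr_finsum (s : ℕ) (r : Fin (s + 1) → ℤ) : FinSumShift {Gn A} (Fr A (s + 1) r) := by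
  induction s with
  | zero => exact FinSumShift.base _ _ _ rfl (Fr_one r)
  | succ s ih =>
    exact FinSumShift.pair _ _ _ (FinSumShift.base _ _ _ rfl (Fr_one _)) (ih _) (Fr_succ _ r)

theorem Fr_zero_summand (r : Fin 0 → ℤ) (Y : DGMod A) : IsHoSummand (Fr A 0 r) Y := by
  refine ⟨DGHom.zero _ _, DGHom.zero _ _, 0, fun j m _ => Submodule.zero_mem _, by simp, fun m => ?_⟩
  funext i; exact i.elim0

theorem Fr_add (s : ℕ) (r : Fin s → ℤ) : Fr A s r ∈ addClosure {Gn A} := by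
  cases s with
  | zero => exact addClosure_summand (mem_addClosure_of_mem rfl) (Fr_zero_summand r _)
  | succ s => exact ⟨_, Fr_finsum s r, IsHoSummand.refl' _⟩

/-! ### Finiteness of cohomology -/
theorem fg_lift {M V : Type} [AddCommGroup M] [Module k M] [AddCommGroup V] [Module k V]
    (f : M →ₗ[k] V) (Z : Submodule k M) (h : (Z.map f).FG) :
    ∃ S ≤ Z, S.FG ∧ Z ≤ S ⊔ (Z ⊓ LinearMap.ker f) := by
  classical
  obtain ⟨t, ht⟩ := h
  have h1 : (t : Set V) ⊆ f '' (Z : Set M) := by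
    rw [← Submodule.map_coe, ← ht]; exact Submodule.subset_span
  obtain ⟨s, hs, hst⟩ := Finset.subset_set_image_iff.1 h1
  refine ⟨Submodule.span k s, Submodule.span_le.2 hs, ⟨s, rfl⟩, fun z hz => ?_⟩
  have h2 : f z ∈ (Submodule.span k (s : Set M)).map f := by
    rw [Submodule.map_span, ← Finset.coe_image, hst, ht]; exact ⟨z, hz, rfl⟩
  obtain ⟨y, hy, hyz⟩ := h2
  refine Submodule.mem_sup.2 ⟨y, hy, z - y, ⟨Z.sub_mem hz (Submodule.span_le.2 hs hy), ?_⟩, by abel⟩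
  simp [hyz]

/-- finite cohomology of a subcomplex -/
def FinH {M : Type} [AddCommGroup M] [Module k M] (D : M →ₗ[k] M) (N : Submodule k M) : Prop :=
  ∃ S ≤ LinearMap.ker D ⊓ N, S.FG ∧ LinearMap.ker D ⊓ N ≤ S ⊔ N.map D

theorem finH_ext {M M' : Type} [AddCommGroup M] [Module k M] [AddCommGroup M'] [Module k M']
    (D : M →ₗ[k] M) (D' : M' →ₗ[k] M') (N N₁ : Submodule k M) (p : M →ₗ[k] M') (c : ℤ)
    (hc : c * c = 1) (hN : N ≤ N₁) (hNN : ∀ x ∈ N₁, p x = 0 → x ∈ N)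
    (hD : ∀ x ∈ N₁, D x ∈ N₁)
    (Dsq : ∀ x, D (D x) = 0) (hp : ∀ x ∈ N₁, p (D x) = c • D' (p x)) (hs : ∀ y, ∃ x ∈ N₁, p x = y)
    (h1 : FinH D N) (h2 : FinH D' ⊤) : FinH D N₁ := by
  obtain ⟨S, hS, hSf, hS'⟩ := h1
  obtain ⟨S2, hS2, hS2f, hS2'⟩ := h2
  let f : M →ₗ[k] M' ⧸ LinearMap.range D' := (LinearMap.range D').mkQ ∘ₗ p
  have hf : ((LinearMap.ker D ⊓ N₁).map f).FG := by
    have hle : (LinearMap.ker D ⊓ N₁).map f ≤ S2.map (LinearMap.range D').mkQ := by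
      rintro _ ⟨z, ⟨hz, hz1⟩, rfl⟩
      have h3 : p z ∈ LinearMap.ker D' ⊓ ⊤ := by
        refine ⟨?_, trivial⟩
        have := hp z hz1
        rw [LinearMap.mem_ker.1 hz, map_zero] at this
        have h4 : c • c • D' (p z) = 0 := by rw [← this, smul_zero]
        rwa [smul_smul, hc, one_smul] at h4
      obtain ⟨u, hu, w, hw, huw⟩ := Submodule.mem_sup.1 (hS2' h3)
      refine ⟨u, hu, ?_⟩
      change (LinearMap.range D').mkQ u = (LinearMap.range D').mkQ (p z)
      rw [← huw, map_add]
      have : (LinearMap.range D').mkQ w = 0 := by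
        rw [Submodule.mkQ_apply, Submodule.Quotient.mk_eq_zero]
        obtain ⟨a, _, ha⟩ := hw; exact ⟨a, ha⟩
      rw [this, add_zero]
    have hfd : FiniteDimensional k (S2.map (LinearMap.range D').mkQ) :=
      Module.Finite.iff_fg.2 (hS2f.map _)
    exact Module.Finite.iff_fg.1 (Submodule.finiteDimensional_of_le hle)
  obtain ⟨S1, hS1, hS1f, hS1'⟩ := fg_lift f _ hf
  refine ⟨S1 ⊔ S, sup_le hS1 (hS.trans (inf_le_inf_left _ hN)), hS1f.sup hSf, hS1'.trans ?_⟩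
  rw [sup_assoc]
  refine sup_le_sup_left ?_ S1
  rintro z ⟨⟨hz, hz1⟩, hzf⟩
  have h3 : p z ∈ LinearMap.range D' := by
    rw [← Submodule.Quotient.mk_eq_zero]; exact hzf
  obtain ⟨y, hy⟩ := h3
  obtain ⟨x, hx, rfl⟩ := hs y
  have h4 : z - c • D x ∈ LinearMap.ker D ⊓ N := by
    refine ⟨?_, hNN _ (N₁.sub_mem hz1 (zsmul_mem' _ _ (hD x hx))) ?_⟩
    · rw [SetLike.mem_coe, LinearMap.mem_ker, map_sub, map_zsmul, Dsq, LinearMap.mem_ker.1 hz]; simp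
    · rw [map_sub, map_zsmul, hp x hx, smul_smul, hc, one_smul, hy, sub_self]
  have h5 := hS' h4
  have h6 : z = (z - c • D x) + c • D x := by abel
  rw [h6]
  refine Submodule.add_mem _ ?_ (Submodule.mem_sup_right (zsmul_mem' _ _ ⟨x, hx, rfl⟩))
  exact (sup_le_sup_left (Submodule.map_mono hN) S) h5

theorem sum_prj {M : Type} [AddCommGroup M] [Module k M] (gm : ℤ → Submodule k M)
    [DirectSum.Decomposition gm] (m : M) : ∃ t : Finset ℤ, m = ∑ n ∈ t, prj gm n m := by
  classical
  have key : ∀ n, ((DirectSum.decompose gm m n : gm n) : M) = prj gm n m := by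
    intro n
    have := hom_ext gm (f := (gm n).subtype ∘ₗ DirectSum.component k ℤ (fun i => gm i) n ∘ₗ
      (DirectSum.decomposeLinearEquiv gm).toLinearMap) (g := prj gm n) (by
        intro j m hm
        by_cases hj : j = n
        · subst hj
          rw [prj_same gm hm]
          exact DirectSum.decompose_of_mem_same gm hm
        · rw [prj_ne gm hm hj]
          exact DirectSum.decompose_of_mem_ne gm hm hj)
    exact congrArg (fun f => f m) this
  refine ⟨(DirectSum.decompose gm m).support, ?_⟩
  conv_lhs => rw [← DirectSum.sum_support_decompose gm m]
  exact Finset.sum_congr rfl fun n _ => key n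

theorem finH_alg (hc : IsCompactAlg A) : FinH A.d ⊤ := by
  classical
  obtain ⟨h1, h2⟩ := hc
  have key : ∀ n, ∃ S ≤ Zg A.gr A.d n, S.FG ∧ Zg A.gr A.d n ≤ S ⊔ Bg A.gr A.d n := by
    intro n
    have hf : FiniteDimensional k (↥(Zg A.gr A.d n) ⧸
      (Submodule.comap (Zg A.gr A.d n).subtype (Bg A.gr A.d n))) := h1 n
    obtain ⟨S, hS, hSf, hS'⟩ := fg_lift (Submodule.comap (Zg A.gr A.d n).subtype (Bg A.gr A.d n)).mkQ ⊤
      (Module.Finite.iff_fg.1 (FiniteDimensional.finiteDimensional_submodule _))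
    refine ⟨S.map (Zg A.gr A.d n).subtype, Submodule.map_subtype_le _ _, hSf.map _, fun z hz => ?_⟩
    obtain ⟨a, ha, b, hb, hab⟩ := Submodule.mem_sup.1 (hS' (Submodule.mem_top (x := ⟨z, hz⟩)))
    refine Submodule.mem_sup.2 ⟨a, ⟨a, ha, rfl⟩, b, ?_, congrArg Subtype.val hab⟩
    have := hb.2
    rw [Submodule.ker_mkQ] at this
    exact this
  have triv : ∀ n, n ∉ h2.toFinset → Zg A.gr A.d n ≤ Bg A.gr A.d n := by
    intro n hn z hz
    have hs : Subsingleton (Hg A.gr A.d n) := by simpa using hn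
    have hs' : Subsingleton (↥(Zg A.gr A.d n) ⧸
      (Submodule.comap (Zg A.gr A.d n).subtype (Bg A.gr A.d n))) := hs
    have h3 : (Submodule.Quotient.mk ⟨z, hz⟩ : ↥(Zg A.gr A.d n) ⧸
      (Submodule.comap (Zg A.gr A.d n).subtype (Bg A.gr A.d n))) = 0 := Subsingleton.elim _ _
    rw [Submodule.Quotient.mk_eq_zero] at h3
    exact h3
  choose S hS hSf hS' using key
  refine ⟨⨆ n ∈ h2.toFinset, S n, iSup₂_le fun n _ => ?_, Submodule.fg_biSup _ _ fun n _ => hSf n, ?_⟩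
  · exact (hS n).trans (le_inf inf_le_right le_top)
  · rintro z ⟨hz, -⟩
    obtain ⟨t, ht⟩ := sum_prj A.gr z
    rw [ht]
    refine Submodule.sum_mem _ fun n _ => ?_
    have hzn : prj A.gr n z ∈ Zg A.gr A.d n := by
      refine ⟨prj_mem _ _ _, ?_⟩
      rw [SetLike.mem_coe, LinearMap.mem_ker, ← prj_comm A.gr A.gr A.d 1 A.d_deg n _ rfl, LinearMap.mem_ker.1 hz,
        map_zero]
    have hB : Bg A.gr A.d n ≤ (⊤ : Submodule k A.R).map A.d := by
      rintro x ⟨_, y, hy⟩; exact ⟨y, trivial, hy⟩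
    by_cases hn : n ∈ h2.toFinset
    · exact (sup_le_sup (le_iSup₂_of_le n hn le_rfl) hB) (hS' n hzn)
    · exact Submodule.mem_sup_right (hB (triv n hn hzn))

theorem finH_tw (hc : IsCompactAlg A) (X : TwData A) : FinH (Tw X (dg A)).D ⊤ := by
  let q : ℕ → Submodule k (Fin X.s → A.R) := fun m =>
    ⨅ i : Fin X.s, ⨅ (_ : m ≤ i.1), LinearMap.ker (LinearMap.proj i)
  have hq : ∀ m v, v ∈ q m ↔ ∀ i : Fin X.s, m ≤ i.1 → v i = 0 := by
    intro m v; simp [q, Submodule.mem_iInf]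
  have hDi : ∀ m, ∀ v ∈ q m, ∀ i : Fin X.s, m ≤ i.1 + 1 →
      (Tw X (dg A)).D v i = sgnz (X.r i) • A.d (v i) := by
    intro m v hv i hi
    rw [Tw_D]
    have : ∑ j, (dg A).actL (X.τ i j) (v j) = 0 := by
      refine Finset.sum_eq_zero fun j _ => ?_
      by_cases hj : i < j
      · rw [(hq m v).1 hv j (by have := Fin.lt_def.1 hj; omega), map_zero]
      · rw [X.tri i j hj]; exact zero_mul _
    rw [this, add_zero]
  have main : ∀ m, m ≤ X.s → FinH (Tw X (dg A)).D (q m) := by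
    intro m
    induction m with
    | zero =>
      intro _
      have h0 : q 0 = ⊥ := by
        rw [eq_bot_iff]
        intro v hv
        rw [Submodule.mem_bot]
        funext i; exact (hq 0 v).1 hv i (Nat.zero_le _)
      refine ⟨⊥, bot_le, Submodule.fg_bot, ?_⟩
      rw [h0]; simp
    | succ m ih =>
      intro hm
      refine finH_ext _ A.d (q m) (q (m + 1)) (LinearMap.proj ⟨m, by omega⟩) (sgnz (X.r ⟨m, by omega⟩))
        (sgnz_mul_self _) ?_ ?_ ?_ (Tw X (dg A)).D_sq ?_ ?_ (ih (by omega)) (finH_alg hc)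
      · intro v hv
        exact (hq _ _).2 fun i hi => (hq _ _).1 hv i (by omega)
      · intro v hv h0
        refine (hq _ _).2 fun i hi => ?_
        rcases Nat.eq_or_lt_of_le hi with h | h
        · have : i = ⟨m, by omega⟩ := Fin.ext h.symm
          rw [this]; exact h0
        · exact (hq _ _).1 hv i h
      · intro v hv
        refine (hq _ _).2 fun i hi => ?_
        rw [hDi _ v hv i (by omega), (hq _ _).1 hv i hi, map_zero, smul_zero]
      · intro v hv
        exact hDi _ v hv _ le_rfl
      · intro y
        classical
        refine ⟨Pi.single ⟨m, by omega⟩ y, (hq _ _).2 fun i hi => ?_, ?_⟩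
        · rw [Pi.single_eq_of_ne]
          rintro rfl
          simp at hi
        · simp
  have ht : q X.s = ⊤ := by
    rw [eq_top_iff]
    intro v _
    exact (hq _ _).2 fun i hi => absurd i.2 (by omega)
  have := main X.s le_rfl
  rwa [ht] at this

theorem finH_cone {X Y : DGMod A} (F : DGHom X Y) (hX : FinH X.D ⊤) (hY : FinH Y.D ⊤) :
    FinH (cone F).D ⊤ := by
  have h1 : FinH (cone F).D (LinearMap.range (LinearMap.inr k X.M Y.M)) := by
    obtain ⟨S, hS, hSf, hS'⟩ := hY
    refine ⟨S.map (LinearMap.inr k X.M Y.M), ?_, hSf.map _, ?_⟩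
    · rintro _ ⟨y, hy, rfl⟩
      refine ⟨?_, ⟨y, rfl⟩⟩
      rw [SetLike.mem_coe, LinearMap.mem_ker, LinearMap.inr_apply, cone_D, LinearMap.mem_ker.1 (hS hy).1]
      simp
    · rintro _ ⟨hy, ⟨y, rfl⟩⟩
      have hy' : Y.D y = 0 := by
        have := congrArg Prod.snd (LinearMap.mem_ker.1 hy)
        rw [LinearMap.inr_apply, cone_D] at this
        simpa using this
      obtain ⟨a, ha, _, ⟨b, _, rfl⟩, hab⟩ := Submodule.mem_sup.1 (hS' ⟨hy', trivial⟩)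
      refine Submodule.mem_sup.2 ⟨_, ⟨a, ha, rfl⟩, _, ⟨_, ⟨b, rfl⟩, rfl⟩, ?_⟩
      rw [← hab, map_add, LinearMap.inr_apply, LinearMap.inr_apply, cone_D]
      simp
  refine finH_ext (cone F).D X.D _ ⊤ (LinearMap.fst k X.M Y.M) (-1) (by norm_num) le_top ?_
    (fun _ _ => trivial) (cone F).D_sq ?_ ?_ h1 hX
  · rintro ⟨x, y⟩ _ h
    simp at h; subst h
    exact ⟨y, rfl⟩
  · rintro ⟨x, y⟩ _
    rw [cone_D]; simp
  · intro x; exact ⟨(x, 0), trivial, rfl⟩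

theorem finH_gens {N : DGMod A} (h : FinH N.D ⊤) :
    ∃ (q : ℕ) (ν : Fin q → ℤ) (z : Fin q → N.M), (∀ i, z i ∈ N.gm (ν i)) ∧ (∀ i, N.D (z i) = 0) ∧
      ∀ w, N.D w = 0 → w ∈ Submodule.span k (Set.range z) ⊔ LinearMap.range N.D := by
  classical
  obtain ⟨S, hS, ⟨t, ht⟩, hS'⟩ := h
  choose u hu using sum_prj N.gm
  let F : Finset N.M := t.biUnion (fun x => (u x).image (fun n => prj N.gm n x))
  have hF : ∀ y ∈ F, ∃ n, y ∈ N.gm n ∧ N.D y = 0 := by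
    intro y hy
    simp only [F, Finset.mem_biUnion, Finset.mem_image] at hy
    obtain ⟨x, hx, n, hn, rfl⟩ := hy
    refine ⟨n, prj_mem _ _ _, ?_⟩
    have : N.D x = 0 := (hS (by rw [← ht]; exact Submodule.subset_span hx)).1
    rw [← prj_comm N.gm N.gm N.D 1 N.D_deg n _ rfl, this, map_zero]
  choose! ν hν using hF
  let z : Fin F.card → N.M := fun i => (F.equivFin.symm i : N.M)
  have hr : Set.range z = (F : Set N.M) := by
    ext y; constructor
    · rintro ⟨i, rfl⟩; exact (F.equivFin.symm i).2
    · intro hy; exact ⟨F.equivFin ⟨y, hy⟩, by simp [z]⟩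
  refine ⟨F.card, fun i => ν (z i), z, fun i => (hν _ (F.equivFin.symm i).2).1,
    fun i => (hν _ (F.equivFin.symm i).2).2, fun w hw => ?_⟩
  have h1 := hS' ⟨LinearMap.mem_ker.2 hw, trivial⟩
  have hle : S ⊔ Submodule.map N.D ⊤ ≤ Submodule.span k (Set.range z) ⊔ LinearMap.range N.D := by
    refine sup_le_sup ?_ ?_
    rotate_left
    · rintro _ ⟨y, _, rfl⟩; exact ⟨y, rfl⟩
    rw [← ht, Submodule.span_le]
    intro x hx
    rw [hr]
    have := hu x
    change x ∈ _
    rw [this]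
    refine Submodule.sum_mem _ fun n hn => Submodule.subset_span ?_
    simp only [F, Finset.coe_biUnion, Set.mem_iUnion]
    exact ⟨x, hx, by simpa using ⟨n, hn, rfl⟩⟩
  exact hle h1

/-! ### Acyclicity of the cone of a twisted quasi-isomorphism -/
theorem qis_inj {P N : DGBimod A} (F : BimodHom P N) (h : QIsoData P.gm P.D N.gm N.D F.f)
    (w : P.M) (hw : P.D w = 0) (b : N.M) (hb : N.D b = F.f w) : ∃ c, P.D c = w := by
  obtain ⟨t, ht⟩ := sum_prj P.gm w
  have key : ∀ n, ∃ c, P.D c = prj P.gm n w := by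
    intro n
    have h1 := ((h.2.2 n).2 (prj P.gm n w) ⟨prj_mem _ _ _, ?_⟩ ⟨F.deg _ _ (prj_mem _ _ _), ?_⟩).2
    · exact h1
    · change P.D _ = 0
      rw [← prj_comm P.gm P.gm P.D 1 P.D_deg n _ rfl, hw, map_zero]
    · refine ⟨prj N.gm (n - 1) b, ?_⟩
      rw [← prj_comm N.gm N.gm N.D 1 N.D_deg (n - 1) n (by ring), hb,
        prj_comm P.gm N.gm F.f 0 (fun j m hm => by simpa using F.deg j m hm) n n (by ring)]
  choose c hc using key
  refine ⟨∑ n ∈ t, c n, ?_⟩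
  rw [map_sum]
  conv_rhs => rw [ht]
  exact Finset.sum_congr rfl fun n _ => hc n

theorem qis_surj {P N : DGBimod A} (F : BimodHom P N) (h : QIsoData P.gm P.D N.gm N.D F.f)
    (z : N.M) (hz : N.D z = 0) : ∃ w, P.D w = 0 ∧ ∃ c, N.D c = F.f w - z := by
  obtain ⟨t, ht⟩ := sum_prj N.gm z
  have key : ∀ n, ∃ w c, P.D w = 0 ∧ N.D c = F.f w - prj N.gm n z := by
    intro n
    obtain ⟨w, hw, hw'⟩ := (h.2.2 n).1 (prj N.gm n z) ⟨prj_mem _ _ _, by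
      change N.D _ = 0
      rw [← prj_comm N.gm N.gm N.D 1 N.D_deg n _ rfl, hz, map_zero]⟩
    obtain ⟨c, hc⟩ := hw'.2
    exact ⟨w, c, hw.2, hc⟩
  choose w c hw hc using key
  refine ⟨∑ n ∈ t, w n, ?_, ∑ n ∈ t, c n, ?_⟩
  · rw [map_sum]; exact Finset.sum_eq_zero fun n _ => hw n
  · rw [map_sum, map_sum]
    conv_rhs => rw [ht]
    rw [← Finset.sum_sub_distrib]
    exact Finset.sum_congr rfl fun n _ => hc n

theorem qis_cone {P N : DGBimod A} (F : BimodHom P N) (h : QIsoData P.gm P.D N.gm N.D F.f)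
    (w : P.M) (b : N.M) (hw : P.D w = 0) (hb : F.f w + N.D b = 0) :
    ∃ w' b', - P.D w' = w ∧ F.f w' + N.D b' = b := by
  obtain ⟨c, hc⟩ := qis_inj F h w hw (-b) (by rw [map_neg]; exact neg_eq_of_add_eq_zero_left hb)
  obtain ⟨u, hu, e, he⟩ := qis_surj F h (b + F.f c) (by rw [map_add, ← F.comm, hc, add_comm, hb])
  refine ⟨u - c, -e, ?_, ?_⟩
  · rw [map_sub, hu, hc]; simp
  · rw [map_sub, map_neg, he]; abel

theorem tw_acyclic (X : TwData A) {P N : DGBimod A} (F : BimodHom P N)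
    (h : QIsoData P.gm P.D N.gm N.D F.f) (m : ℕ) :
    ∀ (v : Fin X.s → P.M) (b : Fin X.s → N.M), (∀ i : Fin X.s, m ≤ i.1 → v i = 0 ∧ b i = 0) →
      (Tw X P).D v = 0 → (TwMap X F).f v + (Tw X N).D b = 0 →
      ∃ v' b', -(Tw X P).D v' = v ∧ (TwMap X F).f v' + (Tw X N).D b' = b := by
  classical
  induction m with
  | zero =>
    intro v b h0 _ _
    have hv : v = 0 := funext fun i => (h0 i (Nat.zero_le _)).1
    have hb : b = 0 := funext fun i => (h0 i (Nat.zero_le _)).2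
    subst hv; subst hb
    exact ⟨0, 0, by rw [map_zero, neg_zero], by rw [map_zero, map_zero, add_zero]⟩
  | succ m ih =>
    intro v b h0 hv hb
    by_cases hm : m < X.s
    · let l : Fin X.s := ⟨m, hm⟩
      have hsum : ∀ (B : DGBimod A) (v : Fin X.s → B.M) (i : Fin X.s), m ≤ i.1 →
          (∀ i : Fin X.s, m + 1 ≤ i.1 → v i = 0) → ∑ j, B.actL (X.τ i j) (v j) = 0 := by
        intro B v i hi hv
        refine Finset.sum_eq_zero fun j _ => ?_
        by_cases hj : m + 1 ≤ j.1
        · rw [hv j hj, map_zero]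
        · rw [X.tri i j (by rw [Fin.lt_def]; omega), map_zero]; rfl
      have h1 := congrFun hv l
      rw [Tw_D, hsum P v l le_rfl (fun i hi => (h0 i hi).1), add_zero] at h1
      have h1' : P.D (v l) = 0 := by
        change _ = (0 : P.M) at h1
        have := congrArg (fun x => sgnz (X.r l) • x) h1
        simpa [sgnz_smul_smul] using this
      have h2 := congrFun hb l
      rw [Pi.add_apply, Tw_D, hsum N b l le_rfl (fun i hi => (h0 i hi).2), add_zero, TwMap_apply,
        ← map_zsmul] at h2
      obtain ⟨w, c, hw, hc⟩ := qis_cone F h _ _ h1' h2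
      let p : Fin X.s → P.M := Pi.single l (sgnz (X.r l) • w)
      let q : Fin X.s → N.M := Pi.single l c
      have hp : ∀ i : Fin X.s, m + 1 ≤ i.1 → p i = 0 := fun i hi =>
        Pi.single_eq_of_ne (by rintro rfl; simp [l] at hi) _
      have hq : ∀ i : Fin X.s, m + 1 ≤ i.1 → q i = 0 := fun i hi =>
        Pi.single_eq_of_ne (by rintro rfl; simp [l] at hi) _
      obtain ⟨v', b', hv', hb'⟩ := ih (v + (Tw X P).D p) (b - ((TwMap X F).f p + (Tw X N).D q))
        (by
          intro i hi
          rw [Pi.add_apply, Pi.sub_apply, Pi.add_apply, Tw_D, Tw_D, TwMap_apply,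
            hsum P p i hi hp, hsum N q i hi hq, add_zero, add_zero]
          by_cases hil : i = l
          · subst hil
            simp only [p, q, Pi.single_eq_same]
            rw [map_zsmul, map_zsmul, sgnz_smul_smul, ← hw, ← smul_add, hc, sgnz_smul_smul]
            simp
          · have hi' : m + 1 ≤ i.1 := by
              have : i.1 ≠ m := fun h => hil (Fin.ext h)
              omega
            rw [hp i hi', hq i hi', (h0 i hi').1, (h0 i hi').2]
            simp)
        (by rw [map_add, hv, (Tw X P).D_sq, add_zero])
        (by
          rw [map_add, map_sub, map_add, (Tw X N).D_sq, ← (TwMap X F).comm, add_zero]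
          rw [← hb]; abel)
      refine ⟨v' + p, b' + q, ?_, ?_⟩
      · rw [map_add, neg_add, hv']; abel
      · rw [map_add, map_add, add_add_add_comm, hb']; abel
    · exact ih v b (fun i hi => absurd i.2 (by omega)) hv hb

theorem cone_acyclic (X : TwData A) {P N : DGBimod A} (F : BimodHom P N)
    (h : QIsoData P.gm P.D N.gm N.D F.f) (n : ℤ) (z : (cone (TwMap X F)).M)
    (_ : z ∈ (cone (TwMap X F)).gm n) (hz : (cone (TwMap X F)).D z = 0) :
    ∃ y, (cone (TwMap X F)).D y = z := by
  obtain ⟨v, b⟩ := z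
  rw [cone_D] at hz
  have h1 := congrArg Prod.fst hz
  have h2 := congrArg Prod.snd hz
  obtain ⟨v', b', hv', hb'⟩ := tw_acyclic X F h X.s v b (fun i hi => absurd i.2 (by omega))
    (neg_eq_zero.1 h1) h2
  exact ⟨(v', b'), by rw [cone_D, hv', hb']⟩

/-! ### Semi-free instances -/
theorem Wf_act {K : Type} [AddCommGroup K] [Module k K] (gmK : ℤ → Submodule k K)
    {W : DGMod A} {s : ℕ} (st : Fin s → K →ₗ[k] W.M) (m : ℕ) (a : A.R) (w : W.M)
    (hw : w ∈ Wf gmK W st m) : W.act a w ∈ Wf gmK W st m := by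
  refine hom_ind A.gr (p := (Wf gmK W st m).comap (W.act.flip w)) (fun n a ha => ?_) a
  have : Wf gmK W st m ≤ (Wf gmK W st m).comap (W.act a) := by
    refine Submodule.span_le.2 ?_
    rintro _ ⟨l, hl, q, t, ht, q', y, hy, rfl⟩
    change W.act a _ ∈ Wf gmK W st m
    rw [← W.act_mul]
    exact Submodule.subset_span ⟨l, hl, q, t, ht, q' + n, y * a, A.mul_mem hy ha, rfl⟩
  exact this hw

theorem Wf_st {K : Type} [AddCommGroup K] [Module k K] (gmK : ℤ → Submodule k K)
    [DirectSum.Decomposition gmK]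
    {W : DGMod A} {s : ℕ} (st : Fin s → K →ₗ[k] W.M) (m : ℕ) (l : Fin s) (hl : l.1 < m) (t : K) :
    st l t ∈ Wf gmK W st m := by
  refine hom_ind gmK (p := (Wf gmK W st m).comap (st l)) (fun n t ht => ?_) t
  exact Submodule.subset_span ⟨l, hl, n, t, ht, 0, 1, A.one_mem, (W.act_one _).symm⟩

def gk (k : Type) [Field k] (n : ℤ) : Submodule k k := if n = 0 then ⊤ else ⊥

@[reducible] def gkDec (k : Type) [Field k] : DirectSum.Decomposition (gk k) :=
  mkDec _ (fun n => if n = 0 then LinearMap.id else 0)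
    (by
      intro n m hm
      by_cases h : n = 0
      · simp [h]
      · simp only [gk, h, if_false, Submodule.mem_bot] at hm; simp [hm])
    (by
      intro n n' h m hm
      by_cases h0 : n = 0
      · subst h0; simp only [gk] at hm; by_cases h1 : n' = 0 <;> simp_all
      · by_cases h1 : n' = 0 <;> simp_all [gk])
    (by
      intro m
      exact Submodule.mem_iSup_of_mem 0 (by simp [gk]))

def stk (X : TwData A) (l : Fin X.s) : k →ₗ[k] (Tw X (dg A)).M :=
  LinearMap.single k (fun _ => A.R) l ∘ₗ Algebra.linearMap k A.R

theorem stk_apply (X : TwData A) (l : Fin X.s) (c : k) :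
    stk X l c = Pi.single l (algebraMap k A.R c) := rfl

theorem semifree_k (X : TwData A) :
    SemiFree (gk k) (0 : k →ₗ[k] k) (Tw X (dg A)) X.r (stk X) := by
  classical
  have hsp : ∀ (v : Fin X.s → A.R), v = ∑ i, (Tw X (dg A)).act (v i) (stk X i 1) := by
    intro v
    funext j
    rw [Finset.sum_apply, Finset.sum_eq_single j]
    · rw [Tw_act, stk_apply, Pi.single_eq_same, map_one]
      exact (one_mul _).symm
    · intro i _ hi
      rw [Tw_act, stk_apply, Pi.single_eq_of_ne hi.symm, map_zero]
    · intro h; exact absurd (Finset.mem_univ _) h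
  let _ := gkDec k
  refine ⟨fun n t _ => Submodule.zero_mem _, fun t => rfl, fun l n t ht => ?_, fun l t => ?_,
    fun w => ?_, fun l N χ c hχ => ?_⟩
  · by_cases h : n = 0
    · subst h
      refine mem_piGr.2 fun j => ?_
      rw [stk_apply]
      by_cases hj : j = l
      · subst hj
        rw [Pi.single_eq_same, show 0 - X.r j + X.r j = 0 by ring, Algebra.algebraMap_eq_smul_one]
        exact Submodule.smul_mem _ _ A.one_mem
      · rw [Pi.single_eq_of_ne hj]; exact Submodule.zero_mem _
    · simp only [gk, h, if_false, Submodule.mem_bot] at ht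
      rw [ht, map_zero]; exact Submodule.zero_mem _
  · rw [LinearMap.zero_apply, map_zero, sub_zero, hsp ((Tw X (dg A)).D (stk X l t))]
    refine Submodule.sum_mem _ fun i _ => ?_
    by_cases hi : i < l
    · exact Wf_act _ _ _ _ _ (Wf_st _ _ _ _ hi _)
    · have : (Tw X (dg A)).D (stk X l t) i = 0 := by
        rw [Tw_D, Finset.sum_eq_zero, add_zero, stk_apply]
        · by_cases hil : i = l
          · subst hil
            rw [Pi.single_eq_same, Algebra.algebraMap_eq_smul_one, map_smul]
            change _ • _ • A.d 1 = _
            rw [d_one, smul_zero, smul_zero]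
          · rw [Pi.single_eq_of_ne hil, map_zero, smul_zero]
        · intro j _
          by_cases hj : j = l
          · subst hj; rw [X.tri i j hi, map_zero]; rfl
          · rw [stk_apply, Pi.single_eq_of_ne hj, map_zero]
      rw [this, map_zero]; exact Submodule.zero_mem _
  · rw [hsp w]
    exact Submodule.sum_mem _ fun i _ => Wf_act _ _ _ _ _ (Wf_st _ _ _ _ i.2 _)
  · refine ⟨N.act.flip (χ 1) ∘ₗ LinearMap.proj l, fun n w hw => ?_, fun x w => ?_, fun t => ?_,
      fun l' hl t => ?_⟩
    · have h1 := hχ 0 1 (by simp [gk])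
      have := N.act_deg _ _ _ _ (mem_piGr.1 hw l) h1
      rw [show 0 - X.r l + c + (n + X.r l) = n + c by ring] at this
      exact this
    · change N.act (w l * x) (χ 1) = N.act x (N.act (w l) (χ 1))
      rw [N.act_mul]
    · change N.act (stk X l t l) (χ 1) = _
      rw [stk_apply, Pi.single_eq_same, Algebra.algebraMap_eq_smul_one, map_smul,
        LinearMap.smul_apply, N.act_one, ← map_smul, smul_eq_mul, mul_one]
    · change N.act (stk X l' t l) (χ 1) = _
      rw [stk_apply, Pi.single_eq_of_ne hl.symm, map_zero]; rfl

theorem tw_section (X : TwData A) {P : DGBimod A} (F : BimodHom P (dg A))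
    (h : QIsoData P.gm P.D A.gr A.d F.f) :
    ∃ σ : DGHom (Tw X (dg A)) (Tw X P), Homotopic ((TwMap X F).comp σ) (DGHom.id _) := by
  let _ := gkDec k
  exact section_of_null _ (null_of_acyclic (gk k) (semifree_k X) (cone_acyclic X F h) _)

instance piDecI {s : ℕ} (r : Fin s → ℤ) {M : Type} [AddCommGroup M] [Module k M]
    (gm : ℤ → Submodule k M) [DirectSum.Decomposition gm] :
    DirectSum.Decomposition (piGr r gm) := piDec r gm

theorem biact_tmul (N : DGBimod A) {q : ℤ} {e : N.M} (he : e ∈ N.gm q) (x y : A.R) :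
    biact N (x ⊗ₜ y) e = N.actL (gop A.gr (fun a => sgnk k (a * q)) x) (N.actR y e) := by
  have := hom_ext A.gr
    (f := (((biact N).flip e) ∘ₗ (TensorProduct.mk k A.R A.R).flip y))
    (g := N.actL.flip (N.actR y e) ∘ₗ gop A.gr (fun a => sgnk k (a * q))) (by
      intro i x hx
      change biact N (x ⊗ₜ y) e = N.actL (gop A.gr (fun a => sgnk k (a * q)) x) (N.actR y e)
      rw [gop_apply A.gr _ hx]
      have h2 : (DirectSum.decomposeLinearEquiv A.gr).toLinearMap x =
          DirectSum.lof k ℤ (fun i => A.gr i) i ⟨x, hx⟩ := DirectSum.decompose_of_mem A.gr hx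
      unfold biact
      rw [TensorProduct.lift.tmul, LinearMap.comp_apply, h2, DirectSum.toModule_lof]
      change N.actL x (N.actR y (gop N.gm (fun j => sgnk k (i * j)) e)) = _
      rw [gop_apply N.gm _ he, map_smul, map_smul, map_smul, LinearMap.smul_apply])
  exact congrArg (fun f => f x) this

def stB (X : TwData A) (B : DGBimod A) {s : ℕ} (e : Fin s → B.M) (l : Fin s) :
    (Tw X (dg A)).M →ₗ[k] (Tw X B).M :=
  LinearMap.pi (fun i => B.actL.flip (e l) ∘ₗ LinearMap.proj i)

theorem stB_apply (X : TwData A) (B : DGBimod A) {s : ℕ} (e : Fin s → B.M) (l : Fin s)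
    (t : Fin X.s → A.R) (i : Fin X.s) : stB X B e l t i = B.actL (t i) (e l) := rfl

theorem Wf_biSpan (X : TwData A) (B : DGBimod A) {s : ℕ} (e : Fin s → B.M) (m : ℕ)
    (p : Submodule k B.M)
    (hp : p = ⨅ t : Fin X.s → A.R, (Wf (Tw X (dg A)).gm (Tw X B) (stB X B e) m).comap
      (LinearMap.pi (fun i => B.actL (t i)))) :
    (∀ b, b ∈ p ↔ ∀ t : Fin X.s → A.R,
      (fun i => B.actL (t i) b) ∈ Wf (Tw X (dg A)).gm (Tw X B) (stB X B e) m) ∧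
    (∀ l : Fin s, l.1 < m → e l ∈ p) ∧ (∀ x b, b ∈ p → B.actL x b ∈ p) ∧
    (∀ x b, b ∈ p → B.actR x b ∈ p) := by
  have h1 : ∀ b, b ∈ p ↔ ∀ t : Fin X.s → A.R,
      (fun i => B.actL (t i) b) ∈ Wf (Tw X (dg A)).gm (Tw X B) (stB X B e) m := by
    intro b
    rw [hp, Submodule.mem_iInf]; rfl
  refine ⟨h1, fun l hl => (h1 _).2 fun t => ?_, fun x b hb => (h1 _).2 fun t => ?_,
    fun x b hb => (h1 _).2 fun t => ?_⟩
  · exact Wf_st (Tw X (dg A)).gm (stB X B e) m l hl t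
  · have := (h1 b).1 hb (fun i => t i * x)
    simpa only [B.actL_mul] using this
  · have := Wf_act _ _ _ x _ ((h1 b).1 hb t)
    have h2 : (fun i => B.actL (t i) (B.actR x b)) = (Tw X B).act x (fun i => B.actL (t i) b) := by
      funext i; rw [Tw_act, B.actLR]
    rw [h2]; exact this

theorem semifree_b (X : TwData A) (B : DGBimod A) {s : ℕ} (r : Fin s → ℤ) (e : Fin s → B.M)
    (he : ∀ j, e j ∈ B.gm (-(r j)))
    (hD : ∀ j, B.D (e j) ∈ biSpan B (e '' {i | i < j}))
    (hb : Function.Bijective (fun v : Fin s → A.R ⊗[k] A.R => ∑ j, biact B (v j) (e j))) :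
    SemiFree (Tw X (dg A)).gm (Tw X (dg A)).D (Tw X B) r (stB X B e) := by
  classical
  let ε : Fin s → A.R →ₗ[k] A.R := fun l => gop A.gr (fun a => sgnk k (a * -(r l)))
  have hε : ∀ l x, ε l (ε l x) = x := by
    intro l x
    have := hom_ext A.gr (f := ε l ∘ₗ ε l) (g := LinearMap.id) (by
      intro i x hx
      simp only [LinearMap.comp_apply, ε, LinearMap.id_apply]
      rw [gop_apply A.gr _ hx, map_smul, gop_apply A.gr _ hx, sgnk_smul, sgnk_smul, sgnz_smul_smul])
    exact congrArg (fun f => f x) this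
  let β : (Fin s → A.R ⊗[k] A.R) →ₗ[k] B.M := ∑ j, (biact B).flip (e j) ∘ₗ LinearMap.proj j
  have hβ : ∀ v, β v = ∑ j, biact B (v j) (e j) := by
    intro v; simp [β, LinearMap.sum_apply]
  have hbij : Function.Bijective β := by
    have : (β : _ → B.M) = fun v => ∑ j, biact B (v j) (e j) := funext hβ
    rw [this]; exact hb
  let κ := LinearEquiv.ofBijective β hbij
  have hκ : ∀ l x y, κ.symm (B.actR y (B.actL x (e l))) = Pi.single l (ε l x ⊗ₜ y) := by
    intro l x y
    rw [LinearEquiv.symm_apply_eq]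
    change _ = β _
    rw [hβ, Finset.sum_eq_single l]
    · rw [Pi.single_eq_same, biact_tmul B (he l)]
      change _ = B.actL (ε l (ε l x)) _
      rw [hε, B.actLR]
    · intro j _ hj
      rw [Pi.single_eq_of_ne hj, map_zero]; rfl
    · intro h; exact absurd (Finset.mem_univ _) h
  have htop : ∀ w, w ∈ Wf (Tw X (dg A)).gm (Tw X B) (stB X B e) s := by
    intro w
    obtain ⟨h1, h2, h3, h4⟩ := Wf_biSpan X B e s _ rfl
    have hall : ∀ b : B.M, b ∈ ⨅ t : Fin X.s → A.R,
        (Wf (Tw X (dg A)).gm (Tw X B) (stB X B e) s).comap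
        (LinearMap.pi (fun i => B.actL (t i))) := by
      intro b
      obtain ⟨v, rfl⟩ := hbij.2 b
      rw [hβ]
      refine Submodule.sum_mem _ fun j _ => ?_
      induction v j using TensorProduct.induction_on with
      | zero => rw [map_zero]; exact Submodule.zero_mem _
      | tmul x y =>
        rw [biact_tmul B (he j)]
        exact h3 _ _ (h4 _ _ (h2 j j.2))
      | add a b ha hb => rw [map_add]; exact Submodule.add_mem _ ha hb
    have hw : w = ∑ i, fun i' => B.actL ((Pi.single i 1 : Fin X.s → A.R) i') (w i) := by
      funext j
      rw [Finset.sum_apply, Finset.sum_eq_single j]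
      · rw [Pi.single_eq_same, B.actL_one]
      · intro i _ hi
        rw [Pi.single_eq_of_ne hi.symm, map_zero]; rfl
      · intro h; exact absurd (Finset.mem_univ _) h
    rw [hw]
    exact Submodule.sum_mem _ fun i _ => (h1 _).1 (hall (w i)) _
  have hdeg : ∀ l n, ∀ t ∈ (Tw X (dg A)).gm n, stB X B e l t ∈ (Tw X B).gm (n - r l) := by
    intro l n t ht
    refine mem_piGr.2 fun i => ?_
    rw [stB_apply]
    have := B.actL_deg _ _ _ _ (mem_piGr.1 ht i) (he l)
    rwa [show n + X.r i + -r l = n - r l + X.r i by ring] at this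
  refine ⟨(Tw X (dg A)).D_deg, (Tw X (dg A)).D_sq, hdeg, fun l t => ?_, htop,
    fun l N χ c hχ => ?_⟩
  · have hmem : ∀ t : Fin X.s → A.R, (fun i => B.actL (t i) (B.D (e l))) ∈
        Wf (Tw X (dg A)).gm (Tw X B) (stB X B e) l.1 := by
      obtain ⟨h1, h2, h3, h4⟩ := Wf_biSpan X B e l.1 _ rfl
      refine (h1 _).1 (Submodule.mem_sInf.1 (hD l) _ ⟨?_, h3, h4⟩)
      rintro _ ⟨i, hi, rfl⟩
      exact h2 i hi
    refine hom_ind (Tw X (dg A)).gm (p := (Wf (Tw X (dg A)).gm (Tw X B) (stB X B e) l.1).comap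
      ((Tw X B).D ∘ₗ stB X B e l - stB X B e l ∘ₗ (Tw X (dg A)).D)) (fun n t ht => ?_) t
    change (Tw X B).D (stB X B e l t) - stB X B e l ((Tw X (dg A)).D t) ∈
      Wf (Tw X (dg A)).gm (Tw X B) (stB X B e) l.1
    have : (Tw X B).D (stB X B e l t) - stB X B e l ((Tw X (dg A)).D t) =
        sgnz n • (fun i => B.actL (t i) (B.D (e l))) := by
      funext i
      rw [Pi.sub_apply, Pi.smul_apply, Tw_D, stB_apply, stB_apply, Tw_D,
        B.leibL (mem_piGr.1 ht i), smul_add, smul_smul, sgnz_add,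
        show sgnz (X.r i) * (sgnz n * sgnz (X.r i)) = sgnz n * (sgnz (X.r i) * sgnz (X.r i)) by ring,
        sgnz_mul_self, mul_one, map_add, map_zsmul, map_sum, LinearMap.add_apply,
        LinearMap.sum_apply]
      have h5 : ∀ j, B.actL ((dg A).actL (X.τ i j) (t j)) (e l) =
          B.actL (X.τ i j) (stB X B e l t j) := by
        intro j
        rw [stB_apply, ← B.actL_mul]; rfl
      simp only [h5]
      change sgnz (X.r i) • B.actL (A.d (t i)) (e l) + _ + _ -
        (sgnz (X.r i) • B.actL (A.d (t i)) (e l) + _) = _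
      abel
    rw [this]
    exact zsmul_mem' _ _ (hmem t)
  · let S : Fin X.s → (A.R ⊗[k] A.R) →ₗ[k] N.M := fun i => TensorProduct.lift
      (N.act.flip ∘ₗ χ ∘ₗ LinearMap.single k (fun _ => A.R) i ∘ₗ ε l)
    have hS : ∀ i x y, S i (x ⊗ₜ y) = N.act y (χ (Pi.single i (ε l x))) := by
      intro i x y; simp [S]
    let Θ : (Fin X.s → B.M) →ₗ[k] N.M := ∑ i, S i ∘ₗ LinearMap.proj l ∘ₗ
      κ.symm.toLinearMap ∘ₗ LinearMap.proj i
    have hΘ : ∀ w, Θ w = ∑ i, S i (κ.symm (w i) l) := by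
      intro w; simp [Θ, LinearMap.sum_apply]
    have key : ∀ y l' t, Θ ((Tw X B).act y (stB X B e l' t)) =
        if l' = l then N.act y (χ t) else 0 := by
      intro y l' t
      rw [hΘ]
      have hk' : ∀ i, κ.symm ((Tw X B).act y (stB X B e l' t) i) =
          Pi.single l' (ε l' (t i) ⊗ₜ y) := fun i => hκ l' (t i) y
      rw [Finset.sum_congr rfl fun i _ => by rw [hk' i]]
      split_ifs with h
      · subst h
        simp only [Pi.single_eq_same, hS, hε]
        rw [← map_sum, ← map_sum]
        congr 2
        exact Finset.univ_sum_single t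
      · simp only [Pi.single_eq_of_ne (Ne.symm h), map_zero, Finset.sum_const_zero]
    have key1 : ∀ l' t, Θ (stB X B e l' t) = if l' = l then χ t else 0 := by
      intro l' t
      have := key 1 l' t
      rwa [(Tw X B).act_one, N.act_one] at this
    refine ⟨Θ, fun n w hw => ?_, fun x w => ?_, fun t => by rw [key1, if_pos rfl],
      fun l' hl t => by rw [key1, if_neg hl]⟩
    · have hle : Wf (Tw X (dg A)).gm (Tw X B) (stB X B e) s ≤
          (N.gm (n + c)).comap (Θ ∘ₗ prj (Tw X B).gm n) := by
        refine Submodule.span_le.2 ?_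
        rintro _ ⟨l', _, q, t, ht, q', y, hy, rfl⟩
        change Θ (prj (Tw X B).gm n _) ∈ N.gm (n + c)
        have hd := (Tw X B).act_deg _ _ _ _ hy (hdeg l' q t ht)
        by_cases hq : q - r l' + q' = n
        · rw [hq] at hd
          rw [prj_same _ hd, key]
          split_ifs with h
          · subst h
            have := N.act_deg _ _ _ _ hy (hχ q t ht)
            rwa [show q - r l' + c + q' = n + c by omega] at this
          · exact Submodule.zero_mem _
        · rw [prj_ne _ hd hq, map_zero]; exact Submodule.zero_mem _
      have := hle (htop w)
      rw [Submodule.mem_comap, LinearMap.comp_apply, prj_same _ hw] at this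
      exact this
    · have hle : Wf (Tw X (dg A)).gm (Tw X B) (stB X B e) s ≤
          LinearMap.ker (Θ ∘ₗ (Tw X B).act x - N.act x ∘ₗ Θ) := by
        refine Submodule.span_le.2 ?_
        rintro _ ⟨l', _, q, t, ht, q', y, hy, rfl⟩
        change Θ ((Tw X B).act x _) - N.act x (Θ _) = 0
        rw [← (Tw X B).act_mul, key, key]
        split_ifs with h
        · rw [N.act_mul, sub_self]
        · rw [map_zero, sub_zero]
      exact sub_eq_zero.1 (hle (htop w))

/-! ### The main construction -/
def fmap {C : DGMod A} {q : ℕ} (c : Fin q → C.M) : (Fin q → A.R) →ₗ[k] C.M :=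
  ∑ i, C.act.flip (c i) ∘ₗ LinearMap.proj i

theorem fmap_apply {C : DGMod A} {q : ℕ} (c : Fin q → C.M) (v : Fin q → A.R) :
    fmap c v = ∑ i, C.act (v i) (c i) := by
  simp [fmap, LinearMap.sum_apply]

theorem fmap_act {C : DGMod A} {q : ℕ} (r : Fin q → ℤ) (c : Fin q → C.M) (x : A.R)
    (v : Fin q → A.R) : fmap c ((Fr A q r).act x v) = C.act x (fmap c v) := by
  rw [fmap_apply, fmap_apply, map_sum]
  refine Finset.sum_congr rfl fun i _ => ?_
  rw [Fr_act, C.act_mul]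

theorem fmap_D {C : DGMod A} {q : ℕ} (r : Fin q → ℤ) (c : Fin q → C.M) (v : Fin q → A.R) :
    fmap c ((Fr A q r).D v) = ∑ i, sgnz (r i) • C.act (A.d (v i)) (c i) := by
  rw [fmap_apply]
  refine Finset.sum_congr rfl fun i _ => ?_
  rw [Fr_D, map_zsmul]; rfl

theorem fmap_single {C : DGMod A} {q : ℕ} (c : Fin q → C.M) (i : Fin q) :
    fmap c (Pi.single i 1) = c i := by
  classical
  rw [fmap_apply, Finset.sum_eq_single i]
  · rw [Pi.single_eq_same, C.act_one]
  · intro j _ hj; rw [Pi.single_eq_of_ne hj, map_zero]; rfl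
  · intro h; exact absurd (Finset.mem_univ _) h

theorem Fr_D_single {q : ℕ} (r : Fin q → ℤ) (i : Fin q) :
    (Fr A q r).D (Pi.single i 1) = 0 := by
  funext j
  rw [Fr_D]
  by_cases h : j = i
  · subst h; rw [Pi.single_eq_same, d_one, smul_zero]; rfl
  · rw [Pi.single_eq_of_ne h, map_zero, smul_zero]; rfl

theorem main_step {C T : DGMod A} (p : DGHom C T) (hc : IsCompactAlg A)
    (hC : FinH C.D ⊤) (hT : FinH T.D ⊤) {m : ℕ} (hCm : C ∈ genLevel (Gn A) m) :
    ∃ (C' : DGMod A) (p' : DGHom C' T) (g : DGHom (cone p) (cone p')),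
      FinH C'.D ⊤ ∧ C' ∈ genLevel (Gn A) (m + 1) ∧ g.comp (coneIncl p) = coneIncl p' ∧
      ∀ n, ∀ z ∈ (cone p).gm n, (cone p).D z = 0 → ∃ y, (cone p').D y = g.f z := by
  obtain ⟨q, ν, z, hz, hzD, hzs⟩ := finH_gens (finH_cone p hC hT)
  let c : Fin q → C.M := fun i => (z i).1
  let t : Fin q → T.M := fun i => (z i).2
  have hcd : ∀ i, c i ∈ C.gm (ν i + 1) := fun i => (hz i).1
  have htd : ∀ i, t i ∈ T.gm (ν i) := fun i => (hz i).2
  have hzp : ∀ i, z i = (c i, t i) := fun i => rfl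
  have hcD : ∀ i, C.D (c i) = 0 := fun i => by
    have := congrArg Prod.fst (hzD i)
    rw [hzp, cone_D] at this
    exact neg_eq_zero.1 this
  have htD : ∀ i, T.D (t i) = - p.f (c i) := fun i => by
    have := congrArg Prod.snd (hzD i)
    rw [hzp, cone_D] at this
    exact eq_neg_of_add_eq_zero_right this
  let r : Fin q → ℤ := fun i => -(ν i + 1)
  have hsg : ∀ i, sgnz (r i) = - sgnz (ν i) := fun i => by
    simp only [r]; rw [sgnz_neg, sgnz_add_one]
  let U := Fr A q r
  let G : DGHom U C := ⟨fmap c, fun n v hv => by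
      rw [fmap_apply]
      refine Submodule.sum_mem _ fun i _ => ?_
      have := C.act_deg _ _ _ _ (mem_piGr.1 hv i) (hcd i)
      rwa [show ν i + 1 + (n + r i) = n by simp only [r]; ring] at this,
    fun x v => fmap_act r c x v, fun v => by
      rw [fmap_D, fmap_apply, map_sum]
      refine Finset.sum_congr rfl fun i _ => ?_
      rw [C.leib (hcd i), hcD, map_zero, zero_add, sgnz_add_one, hsg]⟩
  have hGf : ∀ v, G.f v = ∑ i, C.act (v i) (c i) := fun v => fmap_apply c v
  have hθ : ∀ v : Fin q → A.R, T.D (fmap t v) = - p.f (G.f v) - fmap t (U.D v) := by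
    intro v
    rw [hGf, fmap_D, fmap_apply, map_sum, map_sum, ← Finset.sum_neg_distrib,
      ← Finset.sum_sub_distrib]
    refine Finset.sum_congr rfl fun i _ => ?_
    rw [T.leib (htd i), htD, map_neg, p.actc, hsg, neg_smul, sub_neg_eq_add]
  let p' : DGHom (cone G) T := ⟨LinearMap.coprod (-fmap t) p.f, fun n v hv => by
      obtain ⟨u, d⟩ := v
      obtain ⟨hu, hd⟩ := hv
      rw [LinearMap.coprod_apply]
      refine Submodule.add_mem _ ?_ (p.deg _ _ hd)
      rw [LinearMap.neg_apply, fmap_apply]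
      refine Submodule.neg_mem _ (Submodule.sum_mem _ fun i _ => ?_)
      have := T.act_deg _ _ _ _ (mem_piGr.1 hu i) (htd i)
      rwa [show ν i + (n + 1 + r i) = n by simp only [r]; ring] at this,
    fun x v => by
      obtain ⟨u, d⟩ := v
      rw [cone_act, LinearMap.coprod_apply, LinearMap.coprod_apply, LinearMap.neg_apply,
        LinearMap.neg_apply, fmap_act, p.actc, map_add, map_neg],
    fun v => by
      obtain ⟨u, d⟩ := v
      rw [cone_D, LinearMap.coprod_apply, LinearMap.coprod_apply, LinearMap.neg_apply,
        LinearMap.neg_apply]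
      simp only [map_add, map_neg, hθ, p.comm]
      abel⟩
  have hp' : ∀ u d, p'.f (u, d) = - fmap t u + p.f d := fun u d => rfl
  let g : DGHom (cone p) (cone p') := ⟨LinearMap.prodMap (LinearMap.inr k U.M C.M) LinearMap.id,
    fun n v hv => ⟨⟨Submodule.zero_mem _, hv.1⟩, hv.2⟩,
    fun x v => by
      obtain ⟨d, w⟩ := v
      change (((0 : U.M), C.act x d), T.act x w) = ((U.act x 0, C.act x d), T.act x w)
      rw [map_zero],
    fun v => by
      obtain ⟨d, w⟩ := v
      change (((0 : U.M), - C.D d), p.f d + T.D w) =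
        (-(-U.D 0, G.f 0 + C.D d), (-fmap t 0 + p.f d) + T.D w)
      rw [map_zero, map_zero, map_zero]
      simp⟩
  have hg : ∀ d w, g.f (d, w) = ((0, d), w) := fun d w => rfl
  refine ⟨cone G, p', g, finH_cone G (finH_tw hc _) hC, ?_, rfl, fun n w _ hw => ?_⟩
  · refine mem_addClosure_of_mem ⟨U, C, G, coneIncl G, cone_isCone G, hCm, ?_⟩
    exact ⟨_, Fr_add q (fun i => r i - 1), Fr_shift q r⟩
  · have hle : Submodule.span k (Set.range z) ⊔ LinearMap.range (cone p).D ≤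
        (LinearMap.range (cone p').D).comap g.f := by
      refine sup_le (Submodule.span_le.2 ?_) ?_
      · rintro _ ⟨i, rfl⟩
        refine ⟨-((Pi.single i 1, 0), 0), ?_⟩
        rw [map_neg, cone_D, cone_D, hp', hzp, hg]
        have h3 : fmap t (Pi.single i 1) = t i := fmap_single t i
        have h1 : G.f (Pi.single i 1) = c i := fmap_single c i
        have h2 : U.D (Pi.single i 1) = 0 := Fr_D_single r i
        rw [h1, h2, h3]
        simp
      · rintro _ ⟨y, rfl⟩
        exact ⟨g.f y, (g.comm y).symm⟩
    exact hle (hzs w hw)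

theorem tw_mem_genLevel (hc : IsCompactAlg A) {B P : DGBimod A} {s : ℕ} (r : Fin s → ℤ)
    (e : Fin s → B.M) (he : ∀ j, e j ∈ B.gm (-(r j)))
    (hD : ∀ j, B.D (e j) ∈ biSpan B (e '' {i | i < j}))
    (hb : Function.Bijective (fun v : Fin s → A.R ⊗[k] A.R => ∑ j, biact B (v j) (e j)))
    (ι : BimodHom P B) (ρ : BimodHom B P) (hρ : BimodHomotopic (ρ.comp ι) (BimodHom.id P))
    (F : BimodHom P (dg A)) (hF : QIsoData P.gm P.D A.gr A.d F.f) (X : TwData A) :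
    Tw X (dg A) ∈ genLevel (Gn A) s := by
  have SF := semifree_b X B r e he hD hb
  let T := Tw X (dg A)
  let Ψ : DGHom (Tw X B) T := (TwMap X F).comp (TwMap X ρ)
  have main : ∀ m, m ≤ s → ∃ (C : DGMod A) (p : DGHom C T), FinH C.D ⊤ ∧ C ∈ genLevel (Gn A) m ∧
      PartNull T.gm (Tw X B) (stB X B e) ((coneIncl p).comp Ψ) m := by
    intro m
    induction m with
    | zero =>
      intro _
      exact ⟨Fr A 0 (fun _ => 0), DGHom.zero _ _, finH_tw hc _, Fr_add 0 _, partNull_zero _ _ _⟩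
    | succ m ih =>
      intro hm
      obtain ⟨C, p, hC, hCm, hN⟩ := ih (by omega)
      obtain ⟨C', p', g, hC', hCm', hg, hgh⟩ := main_step p hc hC (finH_tw hc X) hCm
      refine ⟨C', p', hC', hCm', ?_⟩
      have := ghost_step T.gm SF g hgh _ (by omega) hN
      rw [← hg]
      exact this
  obtain ⟨C, p, -, hC, hN⟩ := main s le_rfl
  have h1 := null_of_partNull T.gm SF hN
  obtain ⟨σ, hσ⟩ := tw_section X F hF
  have h2 : Homotopic (Ψ.comp ((TwMap X ι).comp σ)) (DGHom.id T) := by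
    refine Homotopic.trans' ?_ hσ
    have := TwMap_homotopic X hρ
    exact (this.compr σ).compl (TwMap X F)
  have h3 : Homotopic (coneIncl p) (DGHom.zero T (cone p)) := by
    have h4 := h2.compl (coneIncl p)
    have h5 := h1.compr ((TwMap X ι).comp σ)
    exact h4.symm'.trans' h5
  exact genLevel_summand hC (summand_of_null p h3)

/-- Let `A` be a compact homologically smooth DG algebra.  Then
`Ho_per(A)` admits a strong generator: there exist an object `E` and an `n` such
that every object of `Ho_per(A)` (i.e. every homotopy direct summand of a twisted
module) lies in `⟨E⟩ₙ`. -/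
theorem strong_generator_exists {k : Type} [Field k] (A : DGAlgebra k)
    (hc : IsCompactAlg A) (hs : IsSmooth A) :
    ∃ (E : DGMod A) (n : ℕ), IsPerfect E ∧
      ∀ T P : DGMod A, IsTwisted T → IsHoSummand P T → P ∈ genLevel E n := by
  obtain ⟨B, P, ⟨s, r, e, he, hD, hb⟩, ⟨ι, ρ, hρ⟩, F, hF⟩ := hs
  refine ⟨Gn A, s, Gn_perfect, fun T Q hT hQ => ?_⟩
  obtain ⟨X, hX⟩ := twisted_coord hT
  exact genLevel_summand (tw_mem_genLevel hc r e he hD hb ι ρ hρ F hF X) (hQ.trans' hX)
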